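/- arXiv:2411.13084 — 5 statements merged into one kernel-verified Lean document; each statement's English description precedes it below -/
import Mathlib

section
/- There exist absolute constants C ≥ 1 and c > 0 such that the following holds. Let G be a group, K ≥ 1 an integer, and μ : G → [0,1] a finitely supported symmetric probability measure with ‖μ∗μ‖₂ ≥ K⁻¹‖μ‖₂. Then there is a (C·K^C)-approximate subgroup H of G such that: (1) |H| ≤ C·K^C / ‖μ‖₂²; (2) H ⊆ supp(μ)⁶, the 6-fold product set of the support of μ; (3) μ(xH) ≥ c·K^{−C} for some x ∈ G. -/
open Pointwise

universe u

section Counting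

variable {G : Type*} [Group G] [DecidableEq G]

/-- If every element of `U` is a product of a pair from `P × Q` in at least `t` ways, then
`|U| t ≤ |P| |Q|`. -/
lemma card_mul_le_of_le_reps {U P Q : Finset G} {t : ℝ}
    (h : ∀ u ∈ U, t ≤ ((P ×ˢ Q).filter fun p ↦ p.1 * p.2 = u).card) :
    (U.card : ℝ) * t ≤ P.card * Q.card := by
  calc (U.card : ℝ) * t = ∑ _u ∈ U, t := by simp
    _ ≤ ∑ u ∈ U, (((P ×ˢ Q).filter fun p ↦ p.1 * p.2 = u).card : ℝ) := Finset.sum_le_sum h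
    _ = ((U.biUnion fun u ↦ (P ×ˢ Q).filter fun p ↦ p.1 * p.2 = u).card : ℝ) := by
        rw [Finset.card_biUnion]
        · push_cast; rfl
        · intro x _ y _ hxy
          refine Finset.disjoint_left.2 fun p hp hp' ↦ ?_
          exact hxy ((Finset.mem_filter.1 hp).2.symm.trans (Finset.mem_filter.1 hp').2)
    _ ≤ ((P ×ˢ Q).card : ℝ) := by
        exact_mod_cast Finset.card_le_card
          (Finset.biUnion_subset.2 fun u _ ↦ Finset.filter_subset _ _)
    _ = P.card * Q.card := by rw [Finset.card_product]; push_cast; rfl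

/-- Inserting a set of popular quotients of `B` between `X` and `Y` costs little. -/
lemma card_mul_popular_mul_le {B S X Y : Finset G} {t : ℝ}
    (hS : ∀ s ∈ S, t ≤ ((B⁻¹ ×ˢ B).filter fun p ↦ p.1 * p.2 = s).card) :
    ((X * S * Y).card : ℝ) * t ≤ (X * B⁻¹).card * (B * Y).card := by
  refine card_mul_le_of_le_reps fun u hu ↦ ?_
  obtain ⟨_, hxs, y, hy, rfl⟩ := Finset.mem_mul.1 hu
  obtain ⟨x, hx, s, hs, rfl⟩ := Finset.mem_mul.1 hxs
  refine (hS s hs).trans ?_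
  norm_cast
  refine Finset.card_le_card_of_injOn (fun p ↦ (x * p.1, p.2 * y)) ?_ ?_
  · intro p hp
    simp only [Finset.coe_filter, Finset.mem_product, Set.mem_ofPred_eq] at hp ⊢
    obtain ⟨⟨h1, h2⟩, rfl⟩ := hp
    exact ⟨⟨Finset.mul_mem_mul hx h1, Finset.mul_mem_mul h2 hy⟩, by group⟩
  · rintro ⟨p, q⟩ - ⟨p', q'⟩ - h
    simpa using h

/-- The number of coincidences among quotients `a b⁻¹` is at most that among `a⁻¹ b`. -/
lemma mulEnergy_inv_right_le (B : Finset G) : B.mulEnergy B⁻¹ ≤ B⁻¹.mulEnergy B := by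
  refine Finset.card_le_card_of_injOn
    (fun x ↦ ((x.1.2⁻¹, x.2.2), (x.1.1, x.2.1⁻¹))) ?_ ?_
  · rintro ⟨⟨a, b⟩, c, d⟩ h
    simp only [Finset.coe_filter, Finset.mem_product, Finset.mem_inv', Set.mem_ofPred_eq] at h ⊢
    obtain ⟨⟨⟨ha, hb⟩, hc, hd⟩, h⟩ := h
    refine ⟨⟨⟨by simpa using hb, hd⟩, ha, hc⟩, ?_⟩
    rw [inv_mul_eq_iff_eq_mul, ← mul_assoc, ← h]
    group
  · rintro ⟨⟨a, b⟩, c, d⟩ - ⟨⟨a', b'⟩, c', d'⟩ - h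
    simp only [Prod.mk.injEq, inv_inj] at h ⊢
    tauto

/-- Tao's popular quotient set of a set `B` with `B B⁻¹` small. -/
lemma exists_popular_quotients {B : Finset G} (hB : B.Nonempty) {L : ℝ} (hL : 1 ≤ L)
    (h : ((B * B⁻¹).card : ℝ) ≤ L * B.card) :
    ∃ S : Finset G, 1 ∈ S ∧ S⁻¹ = S ∧ S ⊆ B⁻¹ * B ∧
      ((B * S ^ 3).card : ℝ) ≤ 8 * L ^ 6 * B.card ∧ (B.card : ℝ) ≤ 2 * L * S.card := by
  set n : ℝ := (B.card : ℝ) with hn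
  have hn0 : 0 < n := by rw [hn]; exact_mod_cast hB.card_pos
  have hL0 : 0 < L := by linarith
  set r : G → ℕ := fun g ↦ ((B⁻¹ ×ˢ B).filter fun p ↦ p.1 * p.2 = g).card
  set t : ℝ := n / (2 * L) with ht
  have ht0 : 0 < t := by positivity
  set S : Finset G := (B⁻¹ * B).filter fun g ↦ t ≤ r g with hSdef
  have hS : ∀ s ∈ S, t ≤ r s := fun s hs ↦ (Finset.mem_filter.1 hs).2
  have hrinv (g : G) : r g⁻¹ = r g := by
    refine Finset.card_bij' (fun p _ ↦ (p.2⁻¹, p.1⁻¹)) (fun p _ ↦ (p.2⁻¹, p.1⁻¹)) ?_ ?_ ?_ ?_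
    · rintro ⟨p, q⟩ hp
      simp only [Finset.mem_filter, Finset.mem_product, Finset.mem_inv'] at hp ⊢
      exact ⟨⟨by simpa using hp.1.2, hp.1.1⟩, by rw [← mul_inv_rev, hp.2, inv_inv]⟩
    · rintro ⟨p, q⟩ hp
      simp only [Finset.mem_filter, Finset.mem_product, Finset.mem_inv'] at hp ⊢
      exact ⟨⟨by simpa using hp.1.2, hp.1.1⟩, by rw [← mul_inv_rev, hp.2]⟩
    · simp
    · simp
  have hrle (g : G) : r g ≤ B.card := by
    refine Finset.card_le_card_of_injOn Prod.snd ?_ ?_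
    · intro p hp
      simp only [Finset.coe_filter, Finset.mem_product, Set.mem_ofPred_eq] at hp
      exact hp.1.2
    · rintro ⟨p, q⟩ hp ⟨p', q'⟩ hp' hq
      simp only [Finset.coe_filter, Finset.mem_product, Set.mem_ofPred_eq] at hp hp' hq
      subst hq
      have := mul_right_cancel (hp.2.trans hp'.2.symm)
      rw [this]
  have hr1 : B.card ≤ r 1 := by
    refine Finset.card_le_card_of_injOn (fun b ↦ (b⁻¹, b)) ?_ ?_
    · intro b hb
      simpa using hb
    · intro a _ b _ hab
      exact (Prod.mk.injEq _ _ _ _ ▸ hab).2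
  have htn : t ≤ n := div_le_self hn0.le (by linarith)
  have hone : 1 ∈ S := by
    obtain ⟨b, hb⟩ := hB
    refine Finset.mem_filter.2
      ⟨Finset.mem_mul.2 ⟨b⁻¹, Finset.inv_mem_inv hb, b, hb, by simp⟩, htn.trans ?_⟩
    rw [hn]; exact_mod_cast hr1
  have hinv : S⁻¹ = S := by
    ext g
    rw [Finset.mem_inv', hSdef, Finset.mem_filter, Finset.mem_filter, hrinv, ← Finset.mem_inv',
      mul_inv_rev, inv_inv]
  refine ⟨S, hone, hinv, Finset.filter_subset _ _, ?_, ?_⟩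
  · set d : ℝ := ((B * B⁻¹).card : ℝ) with hd
    have h1 : ((B * S * B⁻¹).card : ℝ) * t ≤ d * d := card_mul_popular_mul_le hS
    have h2 : ((B * S * S * B⁻¹).card : ℝ) * t ≤ (B * S * B⁻¹).card * d :=
      card_mul_popular_mul_le hS
    have h3 : ((B * S * S * S).card : ℝ) * t ≤ (B * S * S * B⁻¹).card * n := by
      simpa using card_mul_popular_mul_le (X := B * S * S) (Y := {1}) hS
    have e : B * S ^ 3 = B * S * S * S := by simp [pow_succ, mul_assoc]
    rw [e]
    have hd0 : 0 ≤ d := Nat.cast_nonneg _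
    have h4 : ((B * S * S * S).card : ℝ) * t ^ 3 ≤ d ^ 3 * n := by
      calc ((B * S * S * S).card : ℝ) * t ^ 3 = ((B * S * S * S).card * t) * t ^ 2 := by ring
        _ ≤ ((B * S * S * B⁻¹).card * n) * t ^ 2 := by gcongr
        _ = ((B * S * S * B⁻¹).card * t) * (n * t) := by ring
        _ ≤ ((B * S * B⁻¹).card * d) * (n * t) := by gcongr
        _ = ((B * S * B⁻¹).card * t) * (n * d) := by ring
        _ ≤ (d * d) * (n * d) := by gcongr
        _ = d ^ 3 * n := by ring
    have h5 : d ^ 3 * n ≤ (L * n) ^ 3 * n := by gcongr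
    have h6 : (L * n) ^ 3 * n = 8 * L ^ 6 * n * t ^ 3 := by rw [ht]; field_simp; norm_num
    exact le_of_mul_le_mul_right (h4.trans (h5.trans h6.le)) (by positivity)
  · have hE1 : n ^ 3 ≤ L * B⁻¹.mulEnergy B := by
      have h1 : B.card ^ 2 * B.card ^ 2 ≤ (B * B⁻¹).card * B⁻¹.mulEnergy B := by
        have := Finset.le_card_mul_mul_mulEnergy B B⁻¹
        rw [Finset.card_inv] at this
        exact this.trans (Nat.mul_le_mul_left _ (mulEnergy_inv_right_le B))
      have h2 : n ^ 2 * n ^ 2 ≤ (B * B⁻¹).card * (B⁻¹.mulEnergy B : ℝ) := by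
        rw [hn]; exact_mod_cast h1
      have h3 : ((B * B⁻¹).card : ℝ) * B⁻¹.mulEnergy B ≤ L * n * B⁻¹.mulEnergy B := by gcongr
      refine le_of_mul_le_mul_right ?_ hn0
      linarith
    have hE2 : (B⁻¹.mulEnergy B : ℝ) = ∑ g ∈ B⁻¹ * B, (r g : ℝ) ^ 2 := by
      rw [Finset.mulEnergy_eq_sum_sq']
      push_cast
      rfl
    have hsum : ∑ g ∈ B⁻¹ * B, (r g : ℝ) = n * n := by
      rw [hn, ← Nat.cast_mul, ← Nat.cast_sum]
      congr 1
      rw [← Finset.card_eq_sum_card_fiberwise (f := fun p : G × G ↦ p.1 * p.2), Finset.card_product,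
        Finset.card_inv]
      intro p hp
      have := Finset.mem_product.1 hp
      exact Finset.mul_mem_mul this.1 this.2
    have hE3 : ∑ g ∈ B⁻¹ * B, (r g : ℝ) ^ 2 ≤ S.card * n ^ 2 + t * (n * n) := by
      rw [← hsum, ← Finset.sum_filter_add_sum_filter_not (B⁻¹ * B) (fun g ↦ t ≤ r g)]
      refine add_le_add ?_ ?_
      · rw [← nsmul_eq_mul]
        refine Finset.sum_le_card_nsmul _ _ _ fun g _ ↦ ?_
        have : (r g : ℝ) ≤ n := by rw [hn]; exact_mod_cast hrle g
        gcongr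
      · rw [Finset.mul_sum]
        calc _ ≤ ∑ g ∈ (B⁻¹ * B).filter (fun g ↦ ¬ t ≤ r g), t * (r g : ℝ) := by
              refine Finset.sum_le_sum fun g hg ↦ ?_
              have := (not_le.1 (Finset.mem_filter.1 hg).2).le
              rw [sq]; gcongr
          _ ≤ _ := Finset.sum_le_sum_of_subset_of_nonneg (Finset.filter_subset _ _)
              fun g _ _ ↦ by positivity
    have h7 : n ^ 3 ≤ L * (S.card * n ^ 2 + t * (n * n)) :=
      hE1.trans (by rw [hE2]; gcongr)
    have h8 : L * (t * (n * n)) = n ^ 3 / 2 := by rw [ht]; field_simp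
    have h9 : n ^ 2 * n ≤ n ^ 2 * (2 * L * S.card) := by nlinarith
    exact le_of_mul_le_mul_left h9 (by positivity)

end Counting

section Selection

variable {ι : Type*} {A : Finset ι} {μ : ι → ℝ}

lemma sq_sum_le_card_mul_sum_sq_of_subset {B : Finset ι} (hB : B ⊆ A) :
    (∑ a ∈ B, μ a) ^ 2 ≤ B.card * ∑ a ∈ A, μ a ^ 2 := by
  refine sq_sum_le_card_mul_sum_sq.trans ?_
  gcongr

open scoped Classical in
/-- Dependent random choice: some vertex `b` has a large neighbourhood containing few pairs with
few common neighbours. -/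
lemma exists_large_nbhd_few_bad_pairs (hμ : ∀ a, 0 ≤ μ a) (h1 : ∑ a ∈ A, μ a = 1)
    (I bad : ι → ι → Prop) {δ ε : ℝ} (hδ : 0 ≤ δ) (hε : 0 ≤ ε)
    (hI : δ ≤ ∑ b ∈ A, μ b * ∑ a ∈ A with I a b, μ a)
    (hbad : ∀ a ∈ A, ∀ a' ∈ A, bad a a' → ∑ b ∈ A with I a b ∧ I a' b, μ b ≤ ε) :
    ∃ b ∈ A, δ ^ 2 - 8 * ε ≤ (∑ a ∈ A with I a b, μ a) ^ 2 -
      8 * ∑ a ∈ A with I a b, μ a * ∑ a' ∈ (A.filter fun x ↦ I x b) with bad a a', μ a' := by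
  set f : ι → ℝ := fun b ↦ ∑ a ∈ A with I a b, μ a with hf
  set g : ι → ℝ := fun b ↦
    ∑ a ∈ A with I a b, μ a * ∑ a' ∈ (A.filter fun x ↦ I x b) with bad a a', μ a' with hg
  have hsq : δ ^ 2 ≤ ∑ b ∈ A, μ b * f b ^ 2 := by
    have h2 : ∑ b ∈ A, μ b * (2 * δ * f b - δ ^ 2) ≤ ∑ b ∈ A, μ b * f b ^ 2 :=
      Finset.sum_le_sum fun b _ ↦
        mul_le_mul_of_nonneg_left (by nlinarith [sq_nonneg (f b - δ)]) (hμ b)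
    have h3 : ∑ b ∈ A, μ b * (2 * δ * f b - δ ^ 2) =
        2 * δ * (∑ b ∈ A, μ b * f b) - δ ^ 2 * ∑ b ∈ A, μ b := by
      rw [Finset.mul_sum, Finset.mul_sum, ← Finset.sum_sub_distrib]
      exact Finset.sum_congr rfl fun b _ ↦ by ring
    rw [h1] at h3
    nlinarith
  have hgle : ∑ b ∈ A, μ b * g b ≤ ε := by
    have h2 : ∑ b ∈ A, μ b * g b = ∑ a ∈ A, ∑ a' ∈ A, μ a * μ a' *
        (if bad a a' then ∑ b ∈ A with I a b ∧ I a' b, μ b else 0) := by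
      simp only [hg, Finset.sum_filter, Finset.mul_sum, Finset.filter_filter]
      rw [Finset.sum_comm]
      refine Finset.sum_congr rfl fun a _ ↦ ?_
      simp_rw [mul_ite, Finset.mul_sum, mul_zero]
      have : ∀ b ∈ A, (if I a b then ∑ i ∈ A, μ b * (if I i b ∧ bad a i then μ a * μ i else 0)
          else 0) = ∑ i ∈ A, if bad a i then (if I a b ∧ I i b then μ a * μ i * μ b else 0)
          else 0 := by
        intro b _
        split_ifs with hIab
        · refine Finset.sum_congr rfl fun i _ ↦ ?_
          by_cases h3 : I i b <;> by_cases h4 : bad a i <;> simp [h3, h4, hIab]; ring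
        · simp [hIab]
      simp only [mul_ite, mul_zero] at this ⊢
      rw [Finset.sum_congr rfl this, Finset.sum_comm]
      refine Finset.sum_congr rfl fun i _ ↦ ?_
      split_ifs <;> simp
    rw [h2]
    calc _ ≤ ∑ a ∈ A, ∑ a' ∈ A, μ a * μ a' * ε := by
          refine Finset.sum_le_sum fun a ha ↦ Finset.sum_le_sum fun a' ha' ↦ ?_
          refine mul_le_mul_of_nonneg_left ?_ (mul_nonneg (hμ a) (hμ a'))
          split_ifs with h
          · exact hbad a ha a' ha' h
          · exact hε
      _ = ε := by
          simp_rw [← Finset.sum_mul, ← Finset.mul_sum, h1]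
          simp [h1]
  have hne : A.Nonempty := by
    rw [Finset.nonempty_iff_ne_empty]; rintro rfl; simp at h1
  by_contra! hcon
  have hμpos : ∃ b ∈ A, 0 < μ b := by
    by_contra! h
    have := Finset.sum_nonpos h
    linarith
  obtain ⟨b₀, hb₀, hb₀'⟩ := hμpos
  have h5 : ∑ b ∈ A, μ b * (f b ^ 2 - 8 * g b) < ∑ b ∈ A, μ b * (δ ^ 2 - 8 * ε) :=
    Finset.sum_lt_sum (fun b hb ↦ mul_le_mul_of_nonneg_left (hcon b hb).le (hμ b))
      ⟨b₀, hb₀, mul_lt_mul_of_pos_left (hcon b₀ hb₀) hb₀'⟩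
  rw [← Finset.sum_mul, h1] at h5
  have h6 : ∑ b ∈ A, μ b * (f b ^ 2 - 8 * g b) =
      ∑ b ∈ A, μ b * f b ^ 2 - 8 * ∑ b ∈ A, μ b * g b := by
    rw [Finset.mul_sum, ← Finset.sum_sub_distrib]
    exact Finset.sum_congr rfl fun b _ ↦ by ring
  linarith

open scoped Classical in
/-- Markov's inequality: if few pairs are bad, then most vertices are in few bad pairs. -/
lemma half_le_sum_few_bad (hμ : ∀ a, 0 ≤ μ a) (bad : ι → ι → Prop) {m : ℝ} (hm : 0 < m)
    (h1 : ∑ a ∈ A, μ a = m)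
    (h : ∑ a ∈ A, μ a * ∑ a' ∈ A with bad a a', μ a' ≤ m ^ 2 / 8) :
    m / 2 ≤ ∑ a ∈ A with ∑ a' ∈ A with bad a a', μ a' ≤ m / 4, μ a := by
  set f : ι → ℝ := fun a ↦ ∑ a' ∈ A with bad a a', μ a'
  have hf (a : ι) : 0 ≤ f a := Finset.sum_nonneg fun i _ ↦ hμ i
  have h2 : (∑ a ∈ A with ¬ f a ≤ m / 4, μ a) * (m / 4) ≤ m ^ 2 / 8 := by
    rw [Finset.sum_mul]
    refine le_trans (Finset.sum_le_sum fun a ha ↦ ?_) ((Finset.sum_le_sum_of_subset_of_nonneg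
      (Finset.filter_subset _ _) fun a _ _ ↦ mul_nonneg (hμ a) (hf a)).trans h)
    exact mul_le_mul_of_nonneg_left (not_le.1 (Finset.mem_filter.1 ha).2).le (hμ a)
  have h3 := Finset.sum_filter_add_sum_filter_not A (fun a ↦ f a ≤ m / 4) μ
  rw [h1] at h3
  have h4 : ∑ a ∈ A with ¬ f a ≤ m / 4, μ a ≤ m / 2 := by
    refine le_of_mul_le_mul_right ?_ (show 0 < m / 4 by linarith)
    linarith
  linarith

end Selection

section Measure

variable {G : Type*} [Group G] [DecidableEq G] {A : Finset G} {μ : G → ℝ}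

/-- A set whose popular products carry a positive proportion of the mass contains a large
subset with few quotients. -/
lemma exists_subset_card_mul_inv_le (hμ : ∀ a, 0 ≤ μ a) (h1 : ∑ a ∈ A, μ a = 1)
    {δ M : ℝ} (hM : 0 < M) (hMA : M = ∑ a ∈ A, μ a ^ 2) (hδ : 0 < δ) (Q : Finset G)
    (hQ : (Q.card : ℝ) * (δ * M) ≤ 1)
    (hI : δ ≤ ∑ b ∈ A, μ b * ∑ a ∈ A with a * b ∈ Q, μ a) :
    ∃ B ⊆ A, δ / 4 ≤ ∑ a ∈ B, μ a ∧ ((B * B⁻¹).card : ℝ) * (δ ^ 14 * M) ≤ 2 ^ 20 := by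
  set ε : ℝ := δ ^ 2 / 16 with hε
  have hε0 : 0 < ε := by positivity
  set P : Finset G := (Q * Q⁻¹).filter fun g ↦
    ε ^ 2 / M ≤ ((Q ×ˢ Q⁻¹).filter fun p ↦ p.1 * p.2 = g).card
  have hPcard : (P.card : ℝ) * (ε ^ 2 / M) ≤ Q.card * Q.card := by
    have := card_mul_le_of_le_reps (U := P) (P := Q) (Q := Q⁻¹)
      fun u hu ↦ (Finset.mem_filter.1 hu).2
    rwa [Finset.card_inv] at this
  have hbad : ∀ a ∈ A, ∀ a' ∈ A, a * a'⁻¹ ∉ P →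
      ∑ b ∈ A with a * b ∈ Q ∧ a' * b ∈ Q, μ b ≤ ε := by
    intro a _ a' _ hnot
    by_contra! hlt
    set D := A.filter fun b ↦ a * b ∈ Q ∧ a' * b ∈ Q
    have hD : ε ^ 2 / M ≤ D.card := by
      rw [div_le_iff₀ hM, hMA]
      refine le_trans ?_ (sq_sum_le_card_mul_sum_sq_of_subset (Finset.filter_subset _ _))
      gcongr
    have hDr : D.card ≤ ((Q ×ˢ Q⁻¹).filter fun p ↦ p.1 * p.2 = a * a'⁻¹).card := by
      refine Finset.card_le_card_of_injOn (fun b ↦ (a * b, (a' * b)⁻¹)) ?_ ?_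
      · intro b hb
        have hb' := (Finset.mem_filter.1 hb).2
        simp only [Finset.coe_filter, Finset.mem_product, Set.mem_ofPred_eq]
        exact ⟨⟨hb'.1, Finset.inv_mem_inv hb'.2⟩, by group⟩
      · intro b _ b' _ h
        simpa using congrArg Prod.fst h
    have hDr' : (D.card : ℝ) ≤ ((Q ×ˢ Q⁻¹).filter fun p ↦ p.1 * p.2 = a * a'⁻¹).card := by
      exact_mod_cast hDr
    refine hnot (Finset.mem_filter.2 ⟨?_, hD.trans hDr'⟩)
    have hpos : (0 : ℝ) < D.card := lt_of_lt_of_le (by positivity) hD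
    obtain ⟨b, hb⟩ := Finset.card_pos.1 (Nat.cast_pos.1 hpos)
    have hb' := (Finset.mem_filter.1 hb).2
    exact Finset.mem_mul.2 ⟨a * b, hb'.1, (a' * b)⁻¹, Finset.inv_mem_inv hb'.2, by group⟩
  obtain ⟨b, -, hb⟩ := exists_large_nbhd_few_bad_pairs hμ h1 (fun a b ↦ a * b ∈ Q)
    (fun a a' ↦ a * a'⁻¹ ∉ P) hδ.le hε0.le (by convert hI) (by
      intro a ha a' ha' h
      convert hbad a ha a' ha' h)
  set A' := A.filter fun a ↦ a * b ∈ Q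
  set m := ∑ a ∈ A', μ a with hm
  have hm0 : 0 ≤ m := Finset.sum_nonneg fun i _ ↦ hμ i
  have hbadA' : ∑ a ∈ A', μ a * ∑ a' ∈ A' with a * a'⁻¹ ∉ P, μ a' ≤ m ^ 2 / 8 ∧
      δ ^ 2 / 2 ≤ m ^ 2 := by
    set w := ∑ a ∈ A', μ a * ∑ a' ∈ A' with a * a'⁻¹ ∉ P, μ a'
    have hw0 : 0 ≤ w := Finset.sum_nonneg fun i _ ↦
      mul_nonneg (hμ i) (Finset.sum_nonneg fun i _ ↦ hμ i)
    have hb' : δ ^ 2 - 8 * ε ≤ m ^ 2 - 8 * w := by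
      convert hb
    rw [hε] at hb'
    constructor <;> nlinarith
  have hmδ : δ / 2 ≤ m := by
    refine le_of_sq_le_sq ?_ hm0
    nlinarith [hbadA'.2, sq_nonneg δ]
  have hmpos : 0 < m := by linarith
  have hBsum := half_le_sum_few_bad hμ (fun a a' ↦ a * a'⁻¹ ∉ P) hmpos hm.symm (by
    convert hbadA'.1)
  set B := A'.filter fun a ↦ ∑ a' ∈ A' with a * a'⁻¹ ∉ P, μ a' ≤ m / 4
  have hBsum' : m / 2 ≤ ∑ a ∈ B, μ a := by convert hBsum
  refine ⟨B, (Finset.filter_subset _ _).trans (Finset.filter_subset _ _), by linarith, ?_⟩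
  have hreps : ∀ u ∈ B * B⁻¹, δ ^ 2 / (16 * M) ≤
      ((P ×ˢ P⁻¹).filter fun p ↦ p.1 * p.2 = u).card := by
    intro u hu
    obtain ⟨x, hx, y', hy', rfl⟩ := Finset.mem_mul.1 hu
    obtain ⟨y, hy, rfl⟩ := Finset.mem_inv.1 hy'
    set D := A'.filter fun c ↦ x * c⁻¹ ∈ P ∧ y * c⁻¹ ∈ P with hD
    have hDsum : m / 2 ≤ ∑ c ∈ D, μ c := by
      have hx' := (Finset.mem_filter.1 hx).2
      have hy' := (Finset.mem_filter.1 hy).2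
      have : m ≤ ∑ c ∈ D, μ c + (∑ a' ∈ A' with x * a'⁻¹ ∉ P, μ a' +
          ∑ a' ∈ A' with y * a'⁻¹ ∉ P, μ a') := by
        clear_value A'
        rw [hm, hD, Finset.sum_filter, Finset.sum_filter, Finset.sum_filter,
          ← Finset.sum_add_distrib, ← Finset.sum_add_distrib]
        refine Finset.sum_le_sum fun c _ ↦ ?_
        have := hμ c
        by_cases h3 : x * c⁻¹ ∈ P <;> by_cases h4 : y * c⁻¹ ∈ P <;> simp [h3, h4, this]
      linarith
    have hDcard : δ ^ 2 / (16 * M) ≤ D.card := by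
      rw [div_le_iff₀ (by positivity)]
      have h3 : (∑ c ∈ D, μ c) ^ 2 ≤ D.card * M := by
        rw [hMA]
        exact sq_sum_le_card_mul_sum_sq_of_subset
          ((Finset.filter_subset _ _).trans (Finset.filter_subset _ _))
      have h4 : (δ / 4) ^ 2 ≤ (∑ c ∈ D, μ c) ^ 2 := by
        gcongr
        linarith
      nlinarith
    refine hDcard.trans ?_
    norm_cast
    refine Finset.card_le_card_of_injOn (fun c ↦ (x * c⁻¹, (y * c⁻¹)⁻¹)) ?_ ?_
    · intro c hc
      have hc' := (Finset.mem_filter.1 hc).2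
      simp only [Finset.coe_filter, Finset.mem_product, Set.mem_ofPred_eq]
      exact ⟨⟨hc'.1, Finset.inv_mem_inv hc'.2⟩, by group⟩
    · intro b _ b' _ h
      simpa using congrArg Prod.fst h
  have h2 := card_mul_le_of_le_reps hreps
  rw [Finset.card_inv] at h2
  have hq0 : (0 : ℝ) ≤ Q.card := Nat.cast_nonneg _
  have hPle : (P.card : ℝ) * (δ ^ 6 * M) ≤ 256 := by
    have e : (P.card : ℝ) * (δ ^ 6 * M) =
        256 * ((P.card * (ε ^ 2 / M)) * (δ * M) ^ 2) := by
      rw [hε]; field_simp; norm_num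
    rw [e]
    have : (P.card * (ε ^ 2 / M)) * (δ * M) ^ 2 ≤ Q.card * Q.card * (δ * M) ^ 2 := by gcongr
    have h3 : (Q.card : ℝ) * Q.card * (δ * M) ^ 2 = (Q.card * (δ * M)) ^ 2 := by ring
    have h4 : ((Q.card : ℝ) * (δ * M)) ^ 2 ≤ 1 := pow_le_one₀ (by positivity) hQ
    linarith
  have e : ((B * B⁻¹).card : ℝ) * (δ ^ 14 * M) =
      16 * ((B * B⁻¹).card * (δ ^ 2 / (16 * M)) * (δ ^ 6 * M) ^ 2) := by
    field_simp
  rw [e]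
  have h3 : (B * B⁻¹).card * (δ ^ 2 / (16 * M)) * (δ ^ 6 * M) ^ 2 ≤
      P.card * P.card * (δ ^ 6 * M) ^ 2 := by gcongr
  have h4 : (P.card : ℝ) * P.card * (δ ^ 6 * M) ^ 2 = (P.card * (δ ^ 6 * M)) ^ 2 := by ring
  have h5 : ((P.card : ℝ) * (δ ^ 6 * M)) ^ 2 ≤ 256 ^ 2 := by gcongr
  linarith

/-- Popular products carry a positive proportion of the mass when `‖μ∗μ‖₂` is large. -/
lemma exists_popular_products (hμ : ∀ a, 0 ≤ μ a) (hA : ∀ a, a ∉ A → μ a = 0)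
    (h1 : ∑ a ∈ A, μ a = 1) {δ M : ℝ} (hM : 0 < M) (hMA : M = ∑ a ∈ A, μ a ^ 2) (hδ : 0 < δ)
    (h : 2 * δ * M ≤ ∑ x ∈ A * A, (∑ y ∈ A, μ y * μ (y⁻¹ * x)) ^ 2) :
    ∃ Q : Finset G, (Q.card : ℝ) * (δ * M) ≤ 1 ∧
      δ ≤ ∑ b ∈ A, μ b * ∑ a ∈ A with a * b ∈ Q, μ a := by
  set f : G → ℝ := fun x ↦ ∑ y ∈ A, μ y * μ (y⁻¹ * x) with hf
  have hf0 (x : G) : 0 ≤ f x := Finset.sum_nonneg fun y _ ↦ mul_nonneg (hμ _) (hμ _)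
  have hshift (s : Finset G) (φ : G → ℝ) (hφ : ∀ a, 0 ≤ φ a) (hφA : ∀ a, a ∉ A → φ a = 0)
      (e : G → G) (he : e.Injective) : ∑ x ∈ s, φ (e x) ≤ ∑ a ∈ A, φ a := by
    rw [← Finset.sum_image (g := e) (f := φ) he.injOn]
    rw [← Finset.sum_filter_of_ne (p := (· ∈ A)) fun a _ ha ↦ by_contra fun h ↦ ha (hφA a h)]
    exact Finset.sum_le_sum_of_subset_of_nonneg (fun a ha ↦ (Finset.mem_filter.1 ha).2)
      fun a _ _ ↦ hφ a
  have hfM (x : G) : f x ≤ M := by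
    have h2 : ∑ y ∈ A, μ (y⁻¹ * x) ^ 2 ≤ M := by
      rw [hMA]
      exact hshift A (fun a ↦ μ a ^ 2) (fun a ↦ sq_nonneg _) (fun a ha ↦ by simp [hA a ha])
        (fun y ↦ y⁻¹ * x) (fun a b hab ↦ by simpa using hab)
    have h3 : f x ≤ ∑ y ∈ A, (μ y ^ 2 + μ (y⁻¹ * x) ^ 2) / 2 :=
      Finset.sum_le_sum fun y _ ↦ by nlinarith [sq_nonneg (μ y - μ (y⁻¹ * x))]
    rw [← Finset.sum_div, Finset.sum_add_distrib, ← hMA] at h3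
    linarith
  have hfsum : ∑ x ∈ A * A, f x ≤ 1 := by
    rw [hf, Finset.sum_comm]
    calc _ ≤ ∑ y ∈ A, μ y * 1 := by
          refine Finset.sum_le_sum fun y _ ↦ ?_
          rw [← Finset.mul_sum, ← h1]
          exact mul_le_mul_of_nonneg_left
            (hshift _ μ hμ hA (fun x ↦ y⁻¹ * x) (mul_right_injective _)) (hμ y)
      _ = 1 := by simpa using h1
  set Q := (A * A).filter fun x ↦ δ * M ≤ f x
  refine ⟨Q, ?_, ?_⟩
  · rw [← nsmul_eq_mul]
    refine (Finset.card_nsmul_le_sum _ _ _ fun x hx ↦ (Finset.mem_filter.1 hx).2).trans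
      ((Finset.sum_le_sum_of_subset_of_nonneg (Finset.filter_subset _ _)
        fun a _ _ ↦ hf0 a).trans hfsum)
  · have h2 : ∑ x ∈ A * A, f x ^ 2 ≤ (∑ x ∈ Q, f x) * M + δ * M := by
      rw [← Finset.sum_filter_add_sum_filter_not (A * A) (fun x ↦ δ * M ≤ f x)]
      refine add_le_add ?_ ?_
      · rw [Finset.sum_mul]
        refine Finset.sum_le_sum fun x _ ↦ ?_
        rw [sq]
        exact mul_le_mul_of_nonneg_left (hfM x) (hf0 x)
      · calc _ ≤ ∑ x ∈ (A * A).filter (fun x ↦ ¬ δ * M ≤ f x), δ * M * f x := by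
              refine Finset.sum_le_sum fun x hx ↦ ?_
              rw [sq]
              exact mul_le_mul_of_nonneg_right (not_le.1 (Finset.mem_filter.1 hx).2).le (hf0 x)
          _ ≤ ∑ x ∈ A * A, δ * M * f x :=
              Finset.sum_le_sum_of_subset_of_nonneg (Finset.filter_subset _ _)
                fun x _ _ ↦ mul_nonneg (by positivity) (hf0 x)
          _ ≤ δ * M * 1 := by rw [← Finset.mul_sum]; gcongr
          _ = δ * M := mul_one _
    have h3 : δ ≤ ∑ x ∈ Q, f x := by
      refine le_of_mul_le_mul_right ?_ hM
      linarith
    refine h3.trans ?_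
    have h4 : ∑ b ∈ A, μ b * ∑ a ∈ A with a * b ∈ Q, μ a =
        ∑ a ∈ A, μ a * ∑ b ∈ A with a * b ∈ Q, μ b := by
      simp_rw [Finset.sum_filter, Finset.mul_sum]
      rw [Finset.sum_comm]
      refine Finset.sum_congr rfl fun a _ ↦ Finset.sum_congr rfl fun b _ ↦ ?_
      split_ifs
      · ring
      · simp
    rw [h4, hf, Finset.sum_comm]
    refine Finset.sum_le_sum fun y _ ↦ ?_
    rw [← Finset.mul_sum]
    refine mul_le_mul_of_nonneg_left ?_ (hμ y)
    rw [← Finset.sum_filter_of_ne (p := fun x ↦ y⁻¹ * x ∈ A)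
      (fun x _ hx ↦ by_contra fun hn ↦ hx (hA _ hn))]
    refine (Finset.sum_bij (fun x _ ↦ y⁻¹ * x) ?_ ?_ ?_ ?_).le
    · intro x hx
      have := Finset.mem_filter.1 hx
      exact Finset.mem_filter.2 ⟨this.2, by simpa using this.1⟩
    · intro x _ x' _ hxx
      simpa using hxx
    · intro b hb
      have := Finset.mem_filter.1 hb
      exact ⟨y * b, Finset.mem_filter.2 ⟨this.2, by simpa using this.1⟩, by simp⟩
    · intros; rfl

end Measure

set_option exponentiation.threshold 300 in
/-- The combinatorial core: a symmetric set of small tripling, of size comparable to `1 / ‖μ‖₂²`,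
a translate of whose square has large measure. -/
lemma exists_small_tripling_of_le_sum_conv_sq {G : Type*} [Group G] [DecidableEq G] {A : Finset G}
    {μ : G → ℝ} (hμ : ∀ a, 0 ≤ μ a) (hA : ∀ a, a ∉ A → μ a = 0) (h1 : ∑ a ∈ A, μ a = 1)
    {k M : ℝ} (hk : 1 ≤ k) (hM : 0 < M) (hMA : M = ∑ a ∈ A, μ a ^ 2)
    (h : M / k ^ 2 ≤ ∑ x ∈ A * A, (∑ y ∈ A, μ y * μ (y⁻¹ * x)) ^ 2) :
    ∃ S : Finset G, 1 ∈ S ∧ S⁻¹ = S ∧ S ⊆ A⁻¹ * A ∧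
      ((S ^ 3).card : ℝ) ≤ 2 ^ 284 * k ^ 224 * S.card ∧
      ((S ^ 2).card : ℝ) ≤ 2 ^ 277 * k ^ 220 / M ∧
      ∃ x, 1 / (2 ^ 287 * k ^ 226) ≤ ∑ a ∈ A with x⁻¹ * a ∈ S ^ 2, μ a := by
  have hk0 : 0 < k := by linarith
  set δ : ℝ := 1 / (2 * k ^ 2) with hδ
  have hδ0 : 0 < δ := by positivity
  obtain ⟨Q, hQ, hI⟩ := exists_popular_products hμ hA h1 hM hMA hδ0 (by
    refine le_trans (le_of_eq ?_) h
    rw [hδ]; field_simp)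
  obtain ⟨B, hBA, hBsum, hBB⟩ := exists_subset_card_mul_inv_le hμ h1 hM hMA hδ0 Q hQ hI
  have hBne : B.Nonempty := by
    rw [Finset.nonempty_iff_ne_empty]
    rintro rfl
    simp only [Finset.sum_empty] at hBsum
    linarith
  have hBlow : δ ^ 2 / 16 ≤ B.card * M := by
    have h2 := sq_sum_le_card_mul_sum_sq_of_subset (μ := μ) hBA
    rw [← hMA] at h2
    have h3 : (δ / 4) ^ 2 ≤ (∑ a ∈ B, μ a) ^ 2 := by gcongr
    nlinarith
  set L : ℝ := 2 ^ 24 / δ ^ 16 with hL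
  have hLk : L = 2 ^ 40 * k ^ 32 := by rw [hL, hδ]; field_simp
  have hL1 : 1 ≤ L := by
    rw [hLk]
    exact one_le_mul_of_one_le_of_one_le (by norm_num) (one_le_pow₀ hk)
  have hBBL : ((B * B⁻¹).card : ℝ) ≤ L * B.card := by
    refine le_of_mul_le_mul_right ?_ (show 0 < δ ^ 14 * M by positivity)
    have e : L * B.card * (δ ^ 14 * M) = 2 ^ 24 / δ ^ 2 * (B.card * M) := by
      rw [hL]; field_simp
    rw [e]
    refine hBB.trans ?_
    calc (2 : ℝ) ^ 20 = 2 ^ 24 / δ ^ 2 * (δ ^ 2 / 16) := by field_simp; norm_num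
      _ ≤ _ := by gcongr
  obtain ⟨S, hS1, hSinv, hSB, hBS, hcard⟩ := exists_popular_quotients hBne hL1 hBBL
  have hL0 : 0 < L := by linarith
  have hBS' : ((B * S ^ 3).card : ℝ) ≤ 16 * L ^ 7 * S.card := by
    calc _ ≤ 8 * L ^ 6 * (B.card : ℝ) := hBS
      _ ≤ 8 * L ^ 6 * (2 * L * S.card) := by gcongr
      _ = _ := by ring
  have hT : 16 * L ^ 7 = 2 ^ 284 * k ^ 224 := by rw [hLk]; ring
  rw [hT] at hBS'
  have hS3 : ((S ^ 3).card : ℝ) ≤ (B * S ^ 3).card := by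
    exact_mod_cast Finset.card_le_card_mul_left hBne
  refine ⟨S, hS1, hSinv, hSB.trans (Finset.mul_subset_mul (Finset.inv_subset_inv hBA) hBA),
    hS3.trans hBS', ?_, ?_⟩
  · have h2 : ((S ^ 2).card : ℝ) ≤ (S ^ 3).card := by
      exact_mod_cast Finset.card_le_card (Finset.pow_subset_pow_right hS1 (by norm_num))
    have h3 : (B.card : ℝ) ≤ (B * B⁻¹).card := by
      exact_mod_cast Finset.card_le_card_mul_right hBne.inv
    rw [le_div_iff₀ hM]
    have h4 : ((S ^ 2).card : ℝ) ≤ 8 * L ^ 6 * (B * B⁻¹).card :=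
      (h2.trans (hS3.trans hBS)).trans (by gcongr)
    calc ((S ^ 2).card : ℝ) * M ≤ 8 * L ^ 6 * (B * B⁻¹).card * M := by gcongr
      _ = 8 * L ^ 6 / δ ^ 14 * ((B * B⁻¹).card * (δ ^ 14 * M)) := by field_simp
      _ ≤ 8 * L ^ 6 / δ ^ 14 * 2 ^ 20 := by gcongr
      _ = 2 ^ 277 * k ^ 220 := by rw [hLk, hδ]; field_simp; norm_num
  · have hBScard : ((B * S).card : ℝ) ≤ 2 ^ 284 * k ^ 224 * S.card := by
      refine le_trans ?_ hBS'
      have : S ⊆ S ^ 3 := by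
        simpa using Finset.pow_subset_pow_right hS1 (show 1 ≤ 3 by norm_num)
      exact_mod_cast Finset.card_le_card (Finset.mul_subset_mul_left this)
    obtain ⟨F, -, hF, hBF⟩ := Finset.ruzsa_covering_mul ⟨1, hS1⟩ hBScard
    have hcover : ∑ a ∈ B, μ a ≤ ∑ x ∈ F, ∑ a ∈ A with x⁻¹ * a ∈ S ^ 2, μ a := by
      simp_rw [Finset.sum_filter]
      rw [Finset.sum_comm]
      refine (Finset.sum_le_sum fun a ha ↦ ?_).trans
        (Finset.sum_le_sum_of_subset_of_nonneg hBA fun a _ _ ↦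
          Finset.sum_nonneg fun x _ ↦ ?_)
      · obtain ⟨x, hx, s, hs, rfl⟩ := Finset.mem_mul.1 (hBF ha)
        have hs' : s ∈ S ^ 2 := by rwa [div_eq_mul_inv, hSinv, ← sq] at hs
        refine le_trans ?_ (Finset.single_le_sum (fun y _ ↦ ?_) hx)
        · simp [hs']
        · split_ifs
          exacts [hμ _, le_rfl]
      · split_ifs
        exacts [hμ _, le_rfl]
    by_contra! hcon
    have hFne : F.Nonempty := by
      obtain ⟨b, hb⟩ := hBne
      obtain ⟨x, hx, -⟩ := Finset.mem_mul.1 (hBF hb)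
      exact ⟨x, hx⟩
    have h2 := Finset.sum_lt_sum_of_nonempty hFne fun x _ ↦ hcon x
    rw [Finset.sum_const, nsmul_eq_mul] at h2
    have h3 : (F.card : ℝ) * (1 / (2 ^ 287 * k ^ 226)) ≤
        2 ^ 284 * k ^ 224 * (1 / (2 ^ 287 * k ^ 226)) := by gcongr
    have h4 : 2 ^ 284 * k ^ 224 * (1 / (2 ^ 287 * k ^ 226)) = δ / 4 := by
      rw [hδ]; field_simp; norm_num
    linarith

/-- Balog–Szemerédi–Gowers for measures: there are absolute constants
`C ≥ 1`, `c > 0` such that for every group `G`, every integer `K ≥ 1` and every finitely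
supported symmetric probability measure `μ : G → [0,1]` with `‖μ∗μ‖₂ ≥ K⁻¹‖μ‖₂`, there is
a `(C·K^C)`-approximate subgroup `H ⊆ supp(μ)⁶` with `|H| ≤ C·K^C/‖μ‖₂²` and
`μ(xH) ≥ c·K^{−C}` for some `x ∈ G`. -/
theorem BSG_for_measures :
    ∃ C c : ℝ, 1 ≤ C ∧ 0 < c ∧
      ∀ (G : Type u) [Group G] (K : ℕ), 1 ≤ K →
      ∀ μ : G → ℝ,
        (Function.support μ).Finite →
        (∀ g, 0 ≤ μ g ∧ μ g ≤ 1) →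
        (∑ᶠ g, μ g) = 1 →
        (∀ g, μ g⁻¹ = μ g) →
        (K : ℝ)⁻¹ * Real.sqrt (∑ᶠ g, (μ g) ^ 2) ≤
          Real.sqrt (∑ᶠ x, (∑ᶠ y, μ y * μ (y⁻¹ * x)) ^ 2) →
        ∃ H : Set G, H.Finite ∧
          -- `H` is a `(C·K^C)`-approximate subgroup
          (1 : G) ∈ H ∧ H⁻¹ = H ∧
          (∃ F : Set G, F.Finite ∧ (F.ncard : ℝ) ≤ C * (K : ℝ) ^ C ∧ H * H ⊆ F * H) ∧
          -- (1) `|H| ≤ C·K^C/‖μ‖₂²`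
          (H.ncard : ℝ) ≤ C * (K : ℝ) ^ C / (∑ᶠ g, (μ g) ^ 2) ∧
          -- (2) `H ⊆ supp(μ)⁶`
          H ⊆ (Function.support μ) ^ 6 ∧
          -- (3) `μ(xH) ≥ c·K^{−C}` for some `x ∈ G`
          (∃ x : G, c * (K : ℝ) ^ (-C) ≤ ∑ᶠ g ∈ x • H, μ g) := by
  obtain ⟨C, hC⟩ : ∃ C : ℝ, C = 2 ^ 1000 := ⟨_, rfl⟩
  have hC1 : 1 ≤ C := by rw [hC]; exact one_le_pow₀ (by norm_num)
  refine ⟨C, C⁻¹, hC1, by positivity, ?_⟩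
  intro G _ K hK μ hfin hμ01 hsum hsymm hnorm
  classical
  have hμ : ∀ a, 0 ≤ μ a := fun a ↦ (hμ01 a).1
  set A : Finset G := hfin.toFinset with hAdef
  have hAcoe : (A : Set G) = Function.support μ := hfin.coe_toFinset
  have hA : ∀ a, a ∉ A → μ a = 0 := fun a ha ↦ by simpa [hAdef] using ha
  have h1 : ∑ a ∈ A, μ a = 1 := by
    rw [← hsum, finsum_eq_sum_of_support_subset _ hAcoe.ge]
  set M : ℝ := ∑ᶠ g, μ g ^ 2 with hM
  have hMA : M = ∑ a ∈ A, μ a ^ 2 := by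
    refine finsum_eq_sum_of_support_subset _ fun g hg ↦ ?_
    rw [hAcoe]
    exact fun h0 ↦ hg (by simp [h0])
  have hMpos : 0 < M := by
    have h2 := sq_sum_le_card_mul_sum_sq_of_subset (μ := μ) (Finset.Subset.refl A)
    rw [h1, ← hMA] at h2
    have h3 : (0 : ℝ) ≤ A.card := Nat.cast_nonneg _
    by_contra! h4
    nlinarith
  have hconv (x : G) : ∑ᶠ y, μ y * μ (y⁻¹ * x) = ∑ y ∈ A, μ y * μ (y⁻¹ * x) := by
    refine finsum_eq_sum_of_support_subset _ fun g hg ↦ ?_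
    rw [hAcoe]
    exact fun h0 ↦ hg (by simp [h0])
  have henergy : ∑ᶠ x, (∑ᶠ y, μ y * μ (y⁻¹ * x)) ^ 2 =
      ∑ x ∈ A * A, (∑ y ∈ A, μ y * μ (y⁻¹ * x)) ^ 2 := by
    simp_rw [hconv]
    refine finsum_eq_sum_of_support_subset _ fun x hx ↦ ?_
    by_contra hn
    refine hx ?_
    have : ∑ y ∈ A, μ y * μ (y⁻¹ * x) = 0 := Finset.sum_eq_zero fun y hy ↦ by
      rw [hA (y⁻¹ * x) fun h0 ↦ hn (Finset.mem_mul.2 ⟨y, hy, _, h0, by simp⟩), mul_zero]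
    simp [this]
  rw [henergy] at hnorm
  have hk : (1 : ℝ) ≤ K := by exact_mod_cast hK
  have hk0 : (0 : ℝ) < K := by linarith
  have hlarge : M / (K : ℝ) ^ 2 ≤ ∑ x ∈ A * A, (∑ y ∈ A, μ y * μ (y⁻¹ * x)) ^ 2 := by
    have h2 := pow_le_pow_left₀ (by positivity) hnorm 2
    rw [mul_pow, Real.sq_sqrt hMpos.le,
      Real.sq_sqrt (Finset.sum_nonneg fun x _ ↦ sq_nonneg _)] at h2
    refine le_trans (le_of_eq ?_) h2
    field_simp
  obtain ⟨S, hS1, hSinv, hSA, hS3, hS2, x, hx⟩ :=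
    exists_small_tripling_of_le_sum_conv_sq hμ hA h1 hk hMpos hMA hlarge
  have hpow (n m : ℕ) (hn : n ≤ 1000) (hm : m ≤ 1000) :
      (2 : ℝ) ^ n * (K : ℝ) ^ m ≤ C * (K : ℝ) ^ C := by
    have h2 : (2 : ℝ) ^ n ≤ C := hC ▸ pow_le_pow_right₀ (by norm_num) hn
    have h3 : (K : ℝ) ^ m ≤ (K : ℝ) ^ C := by
      rw [← Real.rpow_natCast]
      refine Real.rpow_le_rpow_of_exponent_le hk ?_
      calc (m : ℝ) ≤ (1000 : ℕ) := by exact_mod_cast hm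
        _ ≤ (2 : ℝ) ^ 1000 := by
            have := one_add_mul_le_pow (a := (1 : ℝ)) (by norm_num) 1000
            rw [one_add_one_eq_two] at this
            refine le_trans ?_ this
            norm_num
        _ = C := hC.symm
    gcongr
  have happ := IsApproximateSubgroup.of_small_tripling hS1 hSinv hS3
  have hAsymm : A⁻¹ = A := by
    ext a
    simp [hAdef, hsymm]
  have hAne : A.Nonempty := by
    rw [Finset.nonempty_iff_ne_empty]
    intro h0
    simp [h0] at h1
  refine ⟨(S : Set G) ^ 2, by rw [← Finset.coe_pow]; exact Finset.finite_toSet _, happ.one_mem, happ.inv_eq_self, ?_, ?_, ?_,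
    x, ?_⟩
  · obtain ⟨F, hF, hSF⟩ := happ.sq_covBySMul
    refine ⟨F, F.finite_toSet, ?_, ?_⟩
    · rw [Set.ncard_coe_finset]
      refine hF.trans (le_trans (le_of_eq ?_) (hpow 852 672 (by norm_num) (by norm_num)))
      rw [mul_pow, ← pow_mul, ← pow_mul]
    · rw [sq ((S : Set G) ^ 2)] at hSF
      simpa using hSF
  · rw [← Finset.coe_pow, Set.ncard_coe_finset]
    exact hS2.trans
      (div_le_div_of_nonneg_right (hpow 277 220 (by norm_num) (by norm_num)) hMpos.le)
  · rw [← hAcoe, ← Finset.coe_pow, ← Finset.coe_pow, Finset.coe_subset]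
    have h2 : S ^ 2 ⊆ A ^ 4 := by
      rw [hAsymm, ← sq] at hSA
      simpa [← pow_mul] using Finset.pow_subset_pow_left (n := 2) hSA
    have h3 : (1 : G) ∈ A ^ 2 := by
      obtain ⟨a, ha⟩ := hAne
      rw [sq]
      exact Finset.mem_mul.2 ⟨a, ha, a⁻¹, by rw [← hAsymm]; exact Finset.inv_mem_inv ha, by simp⟩
    have h4 := Finset.subset_mul_left (A ^ 4) h3
    rw [← pow_add] at h4
    exact h2.trans h4
  · have hsumx : ∑ᶠ g ∈ x • (S : Set G) ^ 2, μ g = ∑ a ∈ A with x⁻¹ * a ∈ S ^ 2, μ a := by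
      refine finsum_mem_eq_sum_of_inter_support_eq _ ?_
      ext g
      rw [← hAcoe, ← Finset.coe_pow]
      simp only [Set.mem_inter_iff, Set.mem_smul_set_iff_inv_smul_mem, smul_eq_mul,
        Finset.mem_coe, Finset.mem_filter]
      tauto
    rw [hsumx]
    refine le_trans ?_ hx
    rw [Real.rpow_neg hk0.le, ← mul_inv, one_div]
    exact inv_anti₀ (by positivity) (hpow 287 226 (by norm_num) (by norm_num))
end

section
/- For every δ > 0 there exists C ≥ 1 such that the following holds over any field K. Let P₁, P₂ ⊆ ℙ³(K) be two distinct projective planes, let X₁ ⊆ P₁, X₂ ⊆ P₂ and X₃ ⊆ ℙ³(K)∖(P₁∪P₂) be finite sets with |X₁| = |X₂| = |X₃| ≥ C, and let E = {(x₁,x₂,x₃) ∈ X₁×X₂×X₃ : x₁, x₂, x₃ are distinct and collinear}. If |E| ≥ |X₁|^{2−δ}, then there exists a set S ⊆ {γ_{x,y} : x, y ∈ X₃} of bijections of P₁ such that |S| ≥ C⁻¹·|X₁|^{1−4δ} and |{(s,x,y) : s ∈ S, x, y ∈ X₁, s(x) = y}| ≥ C⁻¹·|S|·|X₁|^{1−4δ}.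 -/
open Module

universe u

/-- Three points of `ℙ³(K)` are collinear when their representative vectors lie in a common
2-dimensional linear subspace of `K⁴`. -/
def Coll3 {K : Type u} [Field K] (x y z : Projectivization K (Fin 4 → K)) : Prop :=
  finrank K ↥(x.submodule ⊔ y.submodule ⊔ z.submodule) ≤ 2

/-- The set of points of `ℙ³(K)` on the projective plane given by a linear subspace `W`. -/
def planePts {K : Type u} [Field K] (W : Submodule K (Fin 4 → K)) :
    Set (Projectivization K (Fin 4 → K)) :=
  {p | p.submodule ≤ W}

/-- `f : P₁ → P₁` is the map `γ_{x,y} = η_y⁻¹ ∘ η_x`, where for `z ∉ P₁ ∪ P₂` the bijection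
`η_z : P₁ → P₂` sends `a ∈ P₁` to the unique point of `P₂` on the line through `a` and `z`.
Concretely, `f a = b` iff there is `c ∈ P₂` collinear with `a, x` and collinear with
`b, y`. -/
def IsGammaMap {K : Type u} [Field K] (W₁ W₂ : Submodule K (Fin 4 → K))
    (x y : Projectivization K (Fin 4 → K))
    (f : ↥(planePts W₁) → ↥(planePts W₁)) : Prop :=
  ∀ a b : ↥(planePts W₁),
    f a = b ↔ ∃ c : Projectivization K (Fin 4 → K),
      c ∈ planePts W₂ ∧ Coll3 (↑a) c x ∧ Coll3 (↑b) c y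

section Geometry

variable {K : Type u} [Field K]

lemma Coll3.swap_left {x y z : Projectivization K (Fin 4 → K)} (h : Coll3 x y z) :
    Coll3 y x z := by
  unfold Coll3 at *
  rwa [sup_comm y.submodule]

lemma Coll3.rotate {x y z : Projectivization K (Fin 4 → K)} (h : Coll3 x y z) :
    Coll3 y z x := by
  unfold Coll3 at *
  rwa [sup_assoc, sup_comm] at h

lemma finrank_sup_of_ne {x y : Projectivization K (Fin 4 → K)} (h : x ≠ y) :
    finrank K ↥(x.submodule ⊔ y.submodule) = 2 := by
  have key := Submodule.finrank_sup_add_finrank_inf_eq x.submodule y.submodule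
  rw [Projectivization.finrank_submodule, Projectivization.finrank_submodule] at key
  have hlt : finrank K ↥(x.submodule ⊓ y.submodule) < 1 := by
    by_contra! hge
    have hx : x.submodule ⊓ y.submodule = x.submodule :=
      Submodule.eq_of_le_of_finrank_le inf_le_left
        (by rwa [Projectivization.finrank_submodule])
    have hxy : x.submodule = y.submodule :=
      Submodule.eq_of_le_of_finrank_le (inf_eq_left.mp hx)
        (by simp [Projectivization.finrank_submodule])
    exact h (Projectivization.submodule_injective hxy)
  omega

lemma Coll3.le_sup {x y z : Projectivization K (Fin 4 → K)} (h : Coll3 x y z) (hxy : x ≠ y) :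
    z.submodule ≤ x.submodule ⊔ y.submodule := by
  have := Submodule.eq_of_le_of_finrank_le
    (le_sup_left : x.submodule ⊔ y.submodule ≤ _ ⊔ z.submodule)
    (by rw [finrank_sup_of_ne hxy]; exact h)
  rw [this]
  exact le_sup_right

/-- A line that is not contained in a plane meets it in at most one point. -/
lemma Coll3.eq_of_mem_planePts {W : Submodule K (Fin 4 → K)}
    {a c c' x : Projectivization K (Fin 4 → K)} (hx : x ∉ planePts W) (hax : a ≠ x)
    (hc : c ∈ planePts W) (hc' : c' ∈ planePts W) (h : Coll3 a c x) (h' : Coll3 a c' x) :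
    c = c' := by
  by_contra hne
  have h1 : c.submodule ≤ x.submodule ⊔ a.submodule := h.rotate.rotate.le_sup hax.symm
  have h2 : c'.submodule ≤ x.submodule ⊔ a.submodule := h'.rotate.rotate.le_sup hax.symm
  have heq := Submodule.eq_of_le_of_finrank_le (sup_le h1 h2)
    (by rw [finrank_sup_of_ne hne, finrank_sup_of_ne hax.symm])
  exact hx ((le_sup_left.trans heq.ge).trans (sup_le hc hc'))

/-- A line meets a plane. -/
lemma exists_mem_planePts_coll3 {W : Submodule K (Fin 4 → K)} (hW : finrank K W = 3)
    {a x : Projectivization K (Fin 4 → K)} (hax : a ≠ x) :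
    ∃ c ∈ planePts W, Coll3 a c x := by
  have key := Submodule.finrank_sup_add_finrank_inf_eq (a.submodule ⊔ x.submodule) W
  rw [finrank_sup_of_ne hax, hW] at key
  have hle : finrank K ↥(a.submodule ⊔ x.submodule ⊔ W) ≤ 4 := by
    simpa using Submodule.finrank_le (a.submodule ⊔ x.submodule ⊔ W)
  have hne : (a.submodule ⊔ x.submodule) ⊓ W ≠ ⊥ := by
    rintro h
    rw [h, finrank_bot] at key
    omega
  obtain ⟨v, hv, hv0⟩ := Submodule.exists_mem_ne_zero_of_ne_bot hne
  refine ⟨Projectivization.mk K v hv0, ?_, ?_⟩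
  · simpa [planePts, Projectivization.submodule_mk] using hv.2
  · have hsub : (Projectivization.mk K v hv0).submodule ≤ a.submodule ⊔ x.submodule := by
      rw [Projectivization.submodule_mk, Submodule.span_singleton_le_iff_mem]
      exact hv.1
    refine (Submodule.finrank_mono ?_).trans (finrank_sup_of_ne hax).le
    exact sup_le (sup_le le_sup_left hsub) le_sup_right

lemma exists_isGammaMap {W₁ W₂ : Submodule K (Fin 4 → K)} (h₁ : finrank K W₁ = 3)
    (h₂ : finrank K W₂ = 3) {x y : Projectivization K (Fin 4 → K)}
    (hx : x ∉ planePts W₁ ∧ x ∉ planePts W₂) (hy : y ∉ planePts W₁ ∧ y ∉ planePts W₂) :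
    ∃ f, IsGammaMap W₁ W₂ x y f := by
  have hex : ∀ a : ↥(planePts W₁), ∃ b : ↥(planePts W₁), ∃ c ∈ planePts W₂,
      Coll3 (↑a) c x ∧ Coll3 (↑b) c y := by
    intro a
    obtain ⟨c, hc, hac⟩ := exists_mem_planePts_coll3 h₂ (ne_of_mem_of_not_mem a.2 hx.1)
    obtain ⟨b, hb, hbc⟩ := exists_mem_planePts_coll3 h₁ (ne_of_mem_of_not_mem hc hy.2)
    exact ⟨⟨b, hb⟩, c, hc, hac, hbc.swap_left⟩
  choose f hf using hex
  refine ⟨f, fun a b => ⟨?_, ?_⟩⟩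
  · rintro rfl
    exact hf a
  · rintro ⟨c, hc, hac, hbc⟩
    obtain ⟨c', hc', hac', hbc'⟩ := hf a
    obtain rfl := hac.eq_of_mem_planePts hx.2 (ne_of_mem_of_not_mem a.2 hx.1) hc hc' hac'
    exact Subtype.ext (hbc'.swap_left.eq_of_mem_planePts hy.1 (ne_of_mem_of_not_mem hc hy.2)
      (f a).2 b.2 hbc.swap_left)

lemma IsGammaMap.right_unique {W₁ W₂ : Submodule K (Fin 4 → K)} (h₁ : finrank K W₁ = 3)
    (h₂ : finrank K W₂ = 3) (hW : W₁ ≠ W₂) {x y y' : Projectivization K (Fin 4 → K)}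
    (hx : x ∉ planePts W₁ ∧ x ∉ planePts W₂) {f : ↥(planePts W₁) → ↥(planePts W₁)}
    (hf : IsGammaMap W₁ W₂ x y f) (hf' : IsGammaMap W₁ W₂ x y' f) : y = y' := by
  by_contra hne
  have hline : ∀ v ∈ W₂, v ∉ W₁ → v ∈ y.submodule ⊔ y'.submodule := by
    intro v hv hv'
    have hv0 : v ≠ 0 := fun h => hv' (h ▸ W₁.zero_mem)
    set c := Projectivization.mk K v hv0 with hcdef
    have hvc : v ∈ c.submodule := by
      rw [hcdef, Projectivization.submodule_mk]
      exact Submodule.mem_span_singleton_self v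
    have hc : c ∈ planePts W₂ := by
      simpa [hcdef, planePts, Projectivization.submodule_mk] using hv
    have hc₁ : c ∉ planePts W₁ := fun h => hv' (h hvc)
    obtain ⟨a, ha, hca⟩ := exists_mem_planePts_coll3 h₁ (ne_of_mem_of_not_mem hc hx.2)
    obtain ⟨c₁, hc₁W, hac₁, hbc₁⟩ := (hf ⟨a, ha⟩ _).mp rfl
    obtain ⟨c₂, hc₂W, hac₂, hbc₂⟩ := (hf' ⟨a, ha⟩ _).mp rfl
    have hax := ne_of_mem_of_not_mem ha hx.1
    obtain rfl := hca.swap_left.eq_of_mem_planePts hx.2 hax hc hc₁W hac₁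
    obtain rfl := hca.swap_left.eq_of_mem_planePts hx.2 hax hc hc₂W hac₂
    have hbc := ne_of_mem_of_not_mem (f ⟨a, ha⟩).2 hc₁
    have heq := Submodule.eq_of_le_of_finrank_le (sup_le (hbc₁.le_sup hbc) (hbc₂.le_sup hbc))
      (by rw [finrank_sup_of_ne hne, finrank_sup_of_ne hbc])
    rw [heq]
    exact Submodule.mem_sup_right hvc
  have hnle : ¬ W₂ ≤ W₁ := fun h =>
    hW (Submodule.eq_of_le_of_finrank_le h (by rw [h₁, h₂])).symm
  obtain ⟨v, hv, hv'⟩ := SetLike.not_le_iff_exists.mp hnle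
  have hle : W₂ ≤ y.submodule ⊔ y'.submodule := by
    intro u hu
    by_cases hu₁ : u ∈ W₁
    · have huv := hline (u + v) (W₂.add_mem hu hv)
        (fun h => hv' ((Submodule.add_mem_iff_right _ hu₁).mp h))
      exact (Submodule.add_mem_iff_left _ (hline v hv hv')).mp huv
    · exact hline u hu hu₁
  have := Submodule.finrank_mono hle
  rw [h₂, finrank_sup_of_ne hne] at this
  omega

end Geometry

section Combinatorics

open Finset

variable {α β : Type*} [DecidableEq α]

lemma sq_sum_card_le_card_mul_sum_card_inter (B : Finset β) (A : Finset α) (Z : β → Finset α)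
    (hZ : ∀ x ∈ B, Z x ⊆ A) :
    (∑ x ∈ B, #(Z x)) ^ 2 ≤ #A * ∑ x ∈ B, ∑ y ∈ B, #(Z x ∩ Z y) := by
  have h1 : ∑ x ∈ B, #(Z x) = ∑ c ∈ A, ∑ x ∈ B, if c ∈ Z x then 1 else 0 := by
    rw [sum_comm]
    refine sum_congr rfl fun x hx => ?_
    rw [sum_boole, filter_mem_eq_inter, inter_eq_right.mpr (hZ x hx), Nat.cast_id]
  have h2 : ∑ x ∈ B, ∑ y ∈ B, #(Z x ∩ Z y) =
      ∑ c ∈ A, (∑ x ∈ B, if c ∈ Z x then 1 else 0) ^ 2 := by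
    simp_rw [sq, sum_mul_sum]
    rw [sum_comm (s := A)]
    refine sum_congr rfl fun x hx => ?_
    rw [sum_comm (s := A)]
    refine sum_congr rfl fun y _ => ?_
    have : ∀ c, ((if c ∈ Z x then 1 else 0) * (if c ∈ Z y then 1 else 0) : ℕ) =
        if c ∈ Z x ∩ Z y then 1 else 0 := by
      intro c
      by_cases h : c ∈ Z x <;> simp [h]
    simp_rw [this]
    rw [sum_boole, filter_mem_eq_inter,
      inter_eq_right.mpr (inter_subset_left.trans (hZ x hx)), Nat.cast_id]
  rw [h1, h2]
  exact sq_sum_le_card_mul_sum_sq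

/-- A dense family of subsets has a member meeting many other members in a large set. -/
lemma exists_many_large_inter (B : Finset β) (A : Finset α) (Z : β → Finset α) {δ : ℝ}
    (hAB : #A = #B) (hA : 0 < #A) (hZ : ∀ x ∈ B, Z x ⊆ A)
    (h : (#A : ℝ) ^ ((2 : ℝ) - δ) ≤ ∑ x ∈ B, (#(Z x) : ℝ)) :
    ∃ x ∈ B, ∃ G ⊆ B, (#A : ℝ) ^ (1 - 2 * δ) / 2 ≤ #G ∧
      ∀ y ∈ G, (#A : ℝ) ^ (1 - 2 * δ) / 2 ≤ #(Z x ∩ Z y) := by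
  classical
  set N : ℝ := (#A : ℝ) with hN
  have hN0 : 0 < N := Nat.cast_pos.mpr hA
  set m : ℝ := N ^ (1 - 2 * δ) with hm
  have hB : B.Nonempty := card_pos.mp (hAB ▸ hA)
  have hCS : (∑ x ∈ B, (#(Z x) : ℝ)) ^ 2 ≤ N * ∑ x ∈ B, ∑ y ∈ B, (#(Z x ∩ Z y) : ℝ) := by
    rw [hN]
    exact_mod_cast sq_sum_card_le_card_mul_sum_card_inter B A Z hZ
  have hpow : (N ^ ((2 : ℝ) - δ)) ^ 2 = N * (N * (N * m)) := by
    rw [hm, ← Real.rpow_natCast, ← Real.rpow_mul hN0.le]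
    have : ((2 : ℝ) - δ) * (2 : ℕ) = (1 - 2 * δ) + 1 + 1 + 1 := by push_cast; ring
    rw [this, Real.rpow_add_one hN0.ne', Real.rpow_add_one hN0.ne', Real.rpow_add_one hN0.ne']
    ring
  have htot : N * (N * m) ≤ ∑ x ∈ B, ∑ y ∈ B, (#(Z x ∩ Z y) : ℝ) := by
    have h2 := (pow_le_pow_left₀ (Real.rpow_nonneg hN0.le _) h 2).trans hCS
    rw [hpow] at h2
    exact le_of_mul_le_mul_left h2 hN0
  obtain ⟨x, hx, hxm⟩ : ∃ x ∈ B, N * m ≤ ∑ y ∈ B, (#(Z x ∩ Z y) : ℝ) := by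
    refine exists_le_of_sum_le hB ?_
    rw [sum_const, nsmul_eq_mul, ← hAB]
    exact htot
  refine ⟨x, hx, B.filter fun y => m / 2 ≤ #(Z x ∩ Z y), filter_subset _ _, ?_,
    fun y hy => (mem_filter.mp hy).2⟩
  rw [← sum_filter_add_sum_filter_not B (fun y => m / 2 ≤ (#(Z x ∩ Z y) : ℝ))] at hxm
  have hbig := sum_le_card_nsmul (B.filter fun y => m / 2 ≤ (#(Z x ∩ Z y) : ℝ))
    (fun y => (#(Z x ∩ Z y) : ℝ)) N
    (fun y _ => Nat.cast_le.mpr (card_le_card (inter_subset_left.trans (hZ x hx))))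
  have hsmall := sum_le_card_nsmul (B.filter fun y => ¬ m / 2 ≤ (#(Z x ∩ Z y) : ℝ))
    (fun y => (#(Z x ∩ Z y) : ℝ)) (m / 2)
    (fun y hy => (not_le.mp (mem_filter.mp hy).2).le)
  have hcard : (#(B.filter fun y => ¬ m / 2 ≤ (#(Z x ∩ Z y) : ℝ)) : ℝ) ≤ N := by
    rw [hN, hAB]
    exact_mod_cast card_filter_le _ _
  have hm0 : 0 ≤ m := Real.rpow_nonneg hN0.le _
  rw [nsmul_eq_mul] at hbig hsmall
  have hle := mul_le_mul_of_nonneg_right hcard (div_nonneg hm0 zero_le_two)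
  refine le_of_mul_le_mul_right ?_ hN0
  linarith

end Combinatorics

/-- For every `δ > 0` there is `C ≥ 1` such that over any field `K`, for
distinct projective planes `P₁, P₂ ⊆ ℙ³(K)` and finite sets `X₁ ⊆ P₁`, `X₂ ⊆ P₂`,
`X₃ ⊆ ℙ³(K)∖(P₁∪P₂)` of equal size `≥ C`: if the set `E` of distinct collinear triples of
`X₁ × X₂ × X₃` satisfies `|E| ≥ |X₁|^{2−δ}`, then there is a set
`S ⊆ {γ_{x,y} : x, y ∈ X₃}` of bijections of `P₁` with `|S| ≥ C⁻¹·|X₁|^{1−4δ}` and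
`|{(s,x,y) : s ∈ S, x, y ∈ X₁, s(x) = y}| ≥ C⁻¹·|S|·|X₁|^{1−4δ}`. -/
theorem collinear_triples_give_group_action_energy :
    ∀ δ : ℝ, 0 < δ → ∃ C : ℝ, 1 ≤ C ∧
      ∀ (K : Type u) [Field K],
      ∀ W₁ W₂ : Submodule K (Fin 4 → K), finrank K W₁ = 3 → finrank K W₂ = 3 → W₁ ≠ W₂ →
      ∀ X₁ X₂ X₃ : Finset (Projectivization K (Fin 4 → K)),
        (∀ x ∈ X₁, x ∈ planePts W₁) →
        (∀ x ∈ X₂, x ∈ planePts W₂) →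
        (∀ x ∈ X₃, x ∉ planePts W₁ ∧ x ∉ planePts W₂) →
        X₁.card = X₂.card → X₁.card = X₃.card → C ≤ (X₁.card : ℝ) →
        (X₁.card : ℝ) ^ ((2 : ℝ) - δ) ≤
          ({t : Projectivization K (Fin 4 → K) × Projectivization K (Fin 4 → K) ×
              Projectivization K (Fin 4 → K) |
            t.1 ∈ X₁ ∧ t.2.1 ∈ X₂ ∧ t.2.2 ∈ X₃ ∧
              t.1 ≠ t.2.1 ∧ t.1 ≠ t.2.2 ∧ t.2.1 ≠ t.2.2 ∧
              Coll3 t.1 t.2.1 t.2.2}.ncard : ℝ) →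
        ∃ S : Set (↥(planePts W₁) → ↥(planePts W₁)),
          (∀ f ∈ S, ∃ x ∈ X₃, ∃ y ∈ X₃, IsGammaMap W₁ W₂ x y f) ∧
          C⁻¹ * (X₁.card : ℝ) ^ ((1 : ℝ) - 4 * δ) ≤ (S.ncard : ℝ) ∧
          C⁻¹ * (S.ncard : ℝ) * (X₁.card : ℝ) ^ ((1 : ℝ) - 4 * δ) ≤
            ({q : (↥(planePts W₁) → ↥(planePts W₁)) × ↥(planePts W₁) × ↥(planePts W₁) |
              q.1 ∈ S ∧ ↑q.2.1 ∈ X₁ ∧ ↑q.2.2 ∈ X₁ ∧ q.1 q.2.1 = q.2.2}.ncard : ℝ) := by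
  classical
  intro δ hδ
  refine ⟨2, by norm_num, ?_⟩
  intro K _ W₁ W₂ h₁ h₂ hW X₁ X₂ X₃ hX₁ hX₂ hX₃ h₁₂ h₁₃ hC hE
  have hN1 : (1 : ℝ) ≤ X₁.card := by linarith
  have hpos : 0 < X₁.card := by exact_mod_cast one_pos.trans_le hN1
  let Z : Projectivization K (Fin 4 → K) → Finset (Projectivization K (Fin 4 → K)) :=
    fun x => X₂.filter fun c => ∃ a ∈ X₁, Coll3 a c x
  have hZ : (X₂.card : ℝ) ^ ((2 : ℝ) - δ) ≤ ∑ x ∈ X₃, ((Z x).card : ℝ) := by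
    rw [← h₁₂]
    refine hE.trans ?_
    rw [← Nat.cast_sum, ← Finset.card_sigma, ← Set.ncard_coe_finset, Nat.cast_le]
    refine Set.ncard_le_ncard_of_injOn (fun t => ⟨t.2.2, t.2.1⟩) ?_ ?_ (Finset.finite_toSet _)
    · rintro ⟨a, c, x⟩ ⟨ha, hc, hx, -, -, -, hcoll⟩
      simp only [Finset.mem_coe, Finset.mem_sigma]
      exact ⟨hx, Finset.mem_filter.mpr ⟨hc, a, ha, hcoll⟩⟩
    · rintro ⟨a, c, x⟩ ⟨ha, hc, hx, -, -, -, hcoll⟩ ⟨a', c', x'⟩ ⟨ha', -, -, -, -, -, hcoll'⟩ heq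
      simp only [Sigma.mk.injEq, heq_eq_eq] at heq
      obtain ⟨rfl, rfl⟩ := heq
      obtain rfl : a = a' := hcoll.swap_left.eq_of_mem_planePts (hX₃ _ hx).1
        (ne_of_mem_of_not_mem (hX₂ _ hc) (hX₃ _ hx).2) (hX₁ _ ha) (hX₁ _ ha') hcoll'.swap_left
      rfl
  obtain ⟨x, hx, G, hG, hGcard, hGinter⟩ := exists_many_large_inter X₃ X₂ Z (h₁₂.symm.trans h₁₃)
    (h₁₂ ▸ hpos) (fun _ _ => Finset.filter_subset _ _) hZ
  rw [← h₁₂] at hGcard hGinter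
  have hexp : (X₁.card : ℝ) ^ ((1 : ℝ) - 4 * δ) ≤ (X₁.card : ℝ) ^ ((1 : ℝ) - 2 * δ) :=
    Real.rpow_le_rpow_of_exponent_le hN1 (by linarith)
  have hγ : ∀ y, ∃ f, y ∈ X₃ → IsGammaMap W₁ W₂ x y f := by
    intro y
    by_cases hy : y ∈ X₃
    · obtain ⟨f, hf⟩ := exists_isGammaMap h₁ h₂ (hX₃ x hx) (hX₃ y hy)
      exact ⟨f, fun _ => hf⟩
    · exact ⟨id, fun h => absurd h hy⟩
  choose g hg using hγ
  have hginj : Set.InjOn g G := fun y hy y' hy' heq =>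
    (hg y (hG hy)).right_unique h₁ h₂ hW (hX₃ x hx) (heq ▸ hg y' (hG hy'))
  have hScard : (g '' G).ncard = G.card := by
    rw [hginj.ncard_image, Set.ncard_coe_finset]
  refine ⟨g '' G, ?_, ?_, ?_⟩
  · rintro _ ⟨y, hy, rfl⟩
    exact ⟨x, hx, y, hG hy, hg y (hG hy)⟩
  · rw [hScard]
    linarith
  · have hA : ∀ c, ∃ a : ↥(planePts W₁), c ∈ Z x → ↑a ∈ X₁ ∧ Coll3 (↑a) c x := by
      intro c
      by_cases hc : c ∈ Z x
      · obtain ⟨a, ha, hac⟩ := (Finset.mem_filter.mp hc).2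
        exact ⟨⟨a, hX₁ a ha⟩, fun _ => ⟨ha, hac⟩⟩
      · obtain ⟨a, ha⟩ := Finset.card_pos.mp hpos
        exact ⟨⟨a, hX₁ a ha⟩, fun h => absurd h hc⟩
    choose A hA using hA
    have hcount : (G.sigma fun y => Z x ∩ Z y).card ≤
        {q : (↥(planePts W₁) → ↥(planePts W₁)) × ↥(planePts W₁) × ↥(planePts W₁) |
          q.1 ∈ g '' G ∧ ↑q.2.1 ∈ X₁ ∧ ↑q.2.2 ∈ X₁ ∧ q.1 q.2.1 = q.2.2}.ncard := by
      rw [← Set.ncard_coe_finset]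
      refine Set.ncard_le_ncard_of_injOn (fun p => (g p.1, A p.2, g p.1 (A p.2))) ?_ ?_ ?_
      · rintro ⟨y, c⟩ hp
        simp only [Finset.mem_coe, Finset.mem_sigma, Finset.mem_inter] at hp
        obtain ⟨hy, hcx, hcy⟩ := hp
        obtain ⟨hc, b, hb, hbc⟩ := Finset.mem_filter.mp hcy
        refine ⟨⟨y, hy, rfl⟩, (hA c hcx).1, ?_, rfl⟩
        have : g y (A c) = ⟨b, hX₁ b hb⟩ :=
          (hg y (hG hy) _ _).mpr ⟨c, hX₂ c hc, (hA c hcx).2, hbc⟩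
        simpa [this] using hb
      · rintro ⟨y, c⟩ hp ⟨y', c'⟩ hp' heq
        simp only [Finset.mem_coe, Finset.mem_sigma, Finset.mem_inter] at hp hp'
        simp only [Prod.mk.injEq] at heq
        obtain rfl : y = y' := hginj hp.1 hp'.1 heq.1
        have hAc' := (hA c' hp'.2.1).2
        rw [← heq.2.1] at hAc'
        obtain rfl : c = c' := (hA c hp.2.1).2.eq_of_mem_planePts (hX₃ x hx).2
          (ne_of_mem_of_not_mem (A c).2 (hX₃ x hx).1)
          (hX₂ c (Finset.mem_filter.mp hp.2.1).1) (hX₂ c' (Finset.mem_filter.mp hp'.2.1).1) hAc'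
        rfl
      · have hfin : (Subtype.val ⁻¹' (X₁ : Set (Projectivization K (Fin 4 → K))) :
            Set ↥(planePts W₁)).Finite :=
          X₁.finite_toSet.preimage Subtype.val_injective.injOn
        exact ((G.finite_toSet.image g).prod (hfin.prod hfin)).subset
          fun q hq => ⟨hq.1, hq.2.1, hq.2.2.1⟩
    have hsum := Finset.card_nsmul_le_sum G (fun y => ((Z x ∩ Z y).card : ℝ)) _ hGinter
    rw [nsmul_eq_mul, ← Nat.cast_sum, ← Finset.card_sigma] at hsum
    rw [hScard]
    refine le_trans ?_ (hsum.trans (Nat.cast_le.mpr hcount))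
    have := mul_le_mul_of_nonneg_left hexp (Nat.cast_nonneg (α := ℝ) G.card)
    linarith
end

section
/- For every ε > 0 there exists C ≥ 1 such that the following holds for every field K. Let G = G(K) be the group with underlying set K × K × K^× and multiplication (a,b,c)(a′,b′,c′) = (a′+ac′, b′+bc′, cc′), acting on the projective plane P₁ = {[0:ξ₁:ξ₂:ξ₃]} ⊆ ℙ³(K) by (a,b,c)·[0:ξ₁:ξ₂:ξ₃] = [0:cξ₁:ξ₂+aξ₁:ξ₃+bξ₁]. Let X₁ ⊆ P₁ be a finite set such that |X₁ ∩ ℓ| ≤ |X₁|^{1−ε} for every projective line ℓ ⊆ P₁. Then |{(p₁,p₂) ∈ X₁ × X₁ : some g ∈ G with g ≠ 1 fixes both p₁ and p₂}| ≤ C·|X₁|^{2−ε}. -/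
/-- The group with underlying set `K × K × Kˣ` and multiplication
`(a,b,c)(a',b',c') = (a'+ac', b'+bc', cc')`. -/
@[ext] structure GK (K : Type*) [Field K] where
  a : K
  b : K
  c : Kˣ

namespace GK

variable {K : Type*} [Field K]

instance : Mul (GK K) :=
  ⟨fun x y => ⟨y.a + x.a * (y.c : K), y.b + x.b * (y.c : K), x.c * y.c⟩⟩

instance : One (GK K) := ⟨⟨0, 0, 1⟩⟩

instance : Inv (GK K) :=
  ⟨fun x => ⟨-(x.a * ((x.c⁻¹ : Kˣ) : K)), -(x.b * ((x.c⁻¹ : Kˣ) : K)), x.c⁻¹⟩⟩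

@[simp] lemma mul_a (x y : GK K) : (x * y).a = y.a + x.a * (y.c : K) := rfl
@[simp] lemma mul_b (x y : GK K) : (x * y).b = y.b + x.b * (y.c : K) := rfl
@[simp] lemma mul_c (x y : GK K) : (x * y).c = x.c * y.c := rfl
@[simp] lemma one_a : (1 : GK K).a = 0 := rfl
@[simp] lemma one_b : (1 : GK K).b = 0 := rfl
@[simp] lemma one_c : (1 : GK K).c = 1 := rfl
@[simp] lemma inv_a (x : GK K) : (x⁻¹).a = -(x.a * ((x.c⁻¹ : Kˣ) : K)) := rfl
@[simp] lemma inv_b (x : GK K) : (x⁻¹).b = -(x.b * ((x.c⁻¹ : Kˣ) : K)) := rfl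
@[simp] lemma inv_c (x : GK K) : (x⁻¹).c = x.c⁻¹ := rfl

instance instGroup : Group (GK K) where
  mul_assoc x y z := by
    ext <;> simp [Units.val_mul] <;> ring
  one_mul x := by ext <;> simp
  mul_one x := by ext <;> simp
  inv_mul_cancel x := by
    ext <;> simp

end GK

universe u

open Module

/-- The plane `P₁ = {[0:ξ₁:ξ₂:ξ₃]}`, i.e. the projectivization of `{v : v 0 = 0} ⊆ K⁴`. -/
def planeW (K : Type u) [Field K] : Submodule K (Fin 4 → K) :=
  LinearMap.ker (LinearMap.proj (R := K) (φ := fun _ : Fin 4 => K) 0)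

/-- The action of `(a,b,c) ∈ G(K)` on homogeneous coordinates of the plane `P₁`:
`(a,b,c)·[0:ξ₁:ξ₂:ξ₃] = [0:cξ₁:ξ₂+aξ₁:ξ₃+bξ₁]`. -/
def actVec {K : Type u} [Field K] (g : GK K) (v : Fin 4 → K) : Fin 4 → K :=
  ![(0 : K), (g.c : K) * v 1, v 2 + g.a * v 1, v 3 + g.b * v 1]

/-- `g` fixes the projective point `p`. -/
def FixesPt {K : Type u} [Field K] (g : GK K) (p : Projectivization K (Fin 4 → K)) : Prop :=
  actVec g p.rep ∈ p.submodule

/-- The line `{ξ₁ = 0}` of the plane `P₁`, which `G(K)` fixes pointwise. -/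
def fixedLine (K : Type u) [Field K] : Submodule K (Fin 4 → K) :=
  Submodule.span K {Pi.single 2 1, Pi.single 3 1}

section

variable {K : Type u} [Field K]

lemma mem_planeW_iff (v : Fin 4 → K) : v ∈ planeW K ↔ v 0 = 0 := by
  simp [planeW]

lemma submodule_le_iff_rep_mem (p : Projectivization K (Fin 4 → K))
    (W : Submodule K (Fin 4 → K)) : p.submodule ≤ W ↔ p.rep ∈ W := by
  rw [p.submodule_eq, Submodule.span_singleton_le_iff_mem]

lemma fixedLine_le_planeW : fixedLine K ≤ planeW K := by
  rw [fixedLine, Submodule.span_le]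
  rintro v (rfl | rfl) <;> simp [mem_planeW_iff]

lemma finrank_span_pair_eq_two {V : Type*} [AddCommGroup V] [Module K V] {v w : V}
    (h : LinearIndependent K ![v, w]) : finrank K (Submodule.span K {v, w}) = 2 := by
  rw [← Matrix.range_cons_cons_empty v w ![]]
  simpa using finrank_span_eq_card h

lemma finrank_fixedLine : finrank K (fixedLine K) = 2 := by
  refine finrank_span_pair_eq_two (LinearIndependent.pair_iff.2 fun s t h => ?_)
  have h2 := congrFun h 2
  have h3 := congrFun h 3
  simp at h2 h3
  exact ⟨h2, h3⟩

lemma mem_fixedLine {v : Fin 4 → K} (h0 : v 0 = 0) (h1 : v 1 = 0) : v ∈ fixedLine K := by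
  rw [fixedLine, Submodule.mem_span_pair]
  refine ⟨v 2, v 3, ?_⟩
  ext i
  fin_cases i <;> simp [h0, h1]

/-- Every vector of the plane lies on a line contained in the plane. -/
lemma exists_line_of_mem_planeW {v : Fin 4 → K} (hv : v ∈ planeW K) :
    ∃ W : Submodule K (Fin 4 → K), finrank K W = 2 ∧ W ≤ planeW K ∧ v ∈ W := by
  by_cases h1 : v 1 = 0
  · exact ⟨fixedLine K, finrank_fixedLine, fixedLine_le_planeW,
      mem_fixedLine ((mem_planeW_iff v).1 hv) h1⟩
  · refine ⟨Submodule.span K {v, Pi.single 3 1}, ?_, ?_, Submodule.subset_span (by simp)⟩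
    · refine finrank_span_pair_eq_two (LinearIndependent.pair_iff.2 fun s t h => ?_)
      have hs := congrFun h 1
      have ht := congrFun h 3
      simp [h1] at hs
      simp [hs] at ht
      exact ⟨hs, ht⟩
    · rw [Submodule.span_le]
      rintro w (rfl | rfl)
      · exact hv
      · simp [mem_planeW_iff]

/-- Coordinates of a fixed point off the line `{ξ₁ = 0}`. -/
lemma FixesPt.sub_one_mul {g : GK K} {p : Projectivization K (Fin 4 → K)} (h : FixesPt g p)
    (h1 : p.rep 1 ≠ 0) :
    ((g.c : K) - 1) * p.rep 2 = g.a * p.rep 1 ∧ ((g.c : K) - 1) * p.rep 3 = g.b * p.rep 1 := by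
  rw [FixesPt, p.submodule_eq, Submodule.mem_span_singleton] at h
  obtain ⟨t, ht⟩ := h
  have e1 := congrFun ht 1
  have e2 := congrFun ht 2
  have e3 := congrFun ht 3
  simp [actVec] at e1 e2 e3
  obtain rfl : t = g.c := e1.resolve_right h1
  constructor
  · linear_combination e2
  · linear_combination e3

/-- A nontrivial element fixes at most one point of the plane off the line `{ξ₁ = 0}`. -/
lemma eq_of_fixesPt {g : GK K} (hg : g ≠ 1) {p q : Projectivization K (Fin 4 → K)}
    (hp : FixesPt g p) (hq : FixesPt g q) (hp0 : p.rep 0 = 0) (hq0 : q.rep 0 = 0)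
    (hp1 : p.rep 1 ≠ 0) (hq1 : q.rep 1 ≠ 0) : p = q := by
  obtain ⟨p2, p3⟩ := hp.sub_one_mul hp1
  obtain ⟨q2, q3⟩ := hq.sub_one_mul hq1
  have hc : (g.c : K) - 1 ≠ 0 := by
    intro hc
    rw [hc, zero_mul] at p2 p3
    refine hg (GK.ext ?_ ?_ (Units.ext (sub_eq_zero.1 hc)))
    · exact (mul_eq_zero.1 p2.symm).resolve_right hp1
    · exact (mul_eq_zero.1 p3.symm).resolve_right hp1
  rw [← p.mk_rep, ← q.mk_rep, Projectivization.mk_eq_mk_iff']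
  have e2 : p.rep 1 * q.rep 2 = p.rep 2 * q.rep 1 :=
    mul_left_cancel₀ hc (by linear_combination p.rep 1 * q2 - q.rep 1 * p2)
  have e3 : p.rep 1 * q.rep 3 = p.rep 3 * q.rep 1 :=
    mul_left_cancel₀ hc (by linear_combination p.rep 1 * q3 - q.rep 1 * p3)
  refine ⟨p.rep 1 / q.rep 1, ?_⟩
  ext i
  fin_cases i <;> simp [hp0, hq0, hq1, div_mul_eq_mul_div, e2, e3]

/-- The pairs of points of `X` with a common nontrivial stabilizer are the diagonal pairs together
with pairs meeting the line `{ξ₁ = 0}`. -/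
lemma ncard_stabilizer_pairs_le (X : Finset (Projectivization K (Fin 4 → K)))
    (hX : ∀ x ∈ X, x.submodule ≤ planeW K) :
    {q : Projectivization K (Fin 4 → K) × Projectivization K (Fin 4 → K) |
        q.1 ∈ X ∧ q.2 ∈ X ∧ ∃ g : GK K, g ≠ 1 ∧ FixesPt g q.1 ∧ FixesPt g q.2}.ncard ≤
      X.card + 2 * (X.card * {x | x ∈ X ∧ x.submodule ≤ fixedLine K}.ncard) := by
  classical
  set L := X.filter fun x => x.submodule ≤ fixedLine K with hL
  have hLn : {x | x ∈ X ∧ x.submodule ≤ fixedLine K}.ncard = L.card := by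
    rw [← Set.ncard_coe_finset, hL, Finset.coe_filter]
  have h0 : ∀ x ∈ X, x.rep 0 = 0 := fun x hx =>
    (mem_planeW_iff _).1 ((submodule_le_iff_rep_mem x _).1 (hX x hx))
  have hmem : ∀ x ∈ X, x.rep 1 = 0 → x ∈ L := fun x hx h1 =>
    Finset.mem_filter.2 ⟨hx, (submodule_le_iff_rep_mem x _).2 (mem_fixedLine (h0 x hx) h1)⟩
  rw [hLn]
  set D := X.diag ∪ (L ×ˢ X ∪ X ×ˢ L) with hD
  calc _ ≤ (D : Set (Projectivization K (Fin 4 → K) × Projectivization K (Fin 4 → K))).ncard := by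
        refine Set.ncard_le_ncard ?_ D.finite_toSet
        rintro ⟨p, q⟩ ⟨hp, hq, g, hg, gp, gq⟩
        simp only [hD, Finset.mem_coe, Finset.mem_union, Finset.mem_diag, Finset.mem_product]
        by_cases hp1 : p.rep 1 = 0
        · exact Or.inr (Or.inl ⟨hmem p hp hp1, hq⟩)
        by_cases hq1 : q.rep 1 = 0
        · exact Or.inr (Or.inr ⟨hp, hmem q hq hq1⟩)
        exact Or.inl ⟨hp, eq_of_fixesPt hg gp gq (h0 p hp) (h0 q hq) hp1 hq1⟩
    _ ≤ X.diag.card + ((L ×ˢ X).card + (X ×ˢ L).card) := by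
        rw [Set.ncard_coe_finset]
        exact (Finset.card_union_le _ _).trans (Nat.add_le_add_left (Finset.card_union_le _ _) _)
    _ = _ := by
        rw [Finset.diag_card, Finset.card_product, Finset.card_product]
        ring

end

/-- For every `ε > 0` there is `C ≥ 1` such that over any field `K`, for
the action of `G(K) = K × K × Kˣ` on the plane `P₁ = {[0:ξ₁:ξ₂:ξ₃]} ⊆ ℙ³(K)` given by
`(a,b,c)·[0:ξ₁:ξ₂:ξ₃] = [0:cξ₁:ξ₂+aξ₁:ξ₃+bξ₁]`, if `X₁ ⊆ P₁` is a finite set with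
`|X₁ ∩ ℓ| ≤ |X₁|^{1−ε}` for every projective line `ℓ ⊆ P₁`, then the number of pairs
`(p₁,p₂) ∈ X₁²` fixed by some `g ≠ 1` is at most `C·|X₁|^{2−ε}`. -/
theorem GK_stabilizer_pairs_bound :
    ∀ ε : ℝ, 0 < ε → ∃ C : ℝ, 1 ≤ C ∧
      ∀ (K : Type u) [Field K],
      ∀ X₁ : Finset (Projectivization K (Fin 4 → K)),
        (∀ x ∈ X₁, x.submodule ≤ planeW K) →
        (∀ W : Submodule K (Fin 4 → K), finrank K W = 2 → W ≤ planeW K →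
          (({x : Projectivization K (Fin 4 → K) | x ∈ X₁ ∧ x.submodule ≤ W}.ncard : ℝ) ≤
            (X₁.card : ℝ) ^ ((1 : ℝ) - ε))) →
        (({q : Projectivization K (Fin 4 → K) × Projectivization K (Fin 4 → K) |
            q.1 ∈ X₁ ∧ q.2 ∈ X₁ ∧
              ∃ g : GK K, g ≠ 1 ∧ FixesPt g q.1 ∧ FixesPt g q.2}.ncard : ℝ) ≤
          C * (X₁.card : ℝ) ^ ((2 : ℝ) - ε)) := by
  intro ε _
  refine ⟨3, by norm_num, fun K _ X hX hline => ?_⟩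
  rcases X.eq_empty_or_nonempty with rfl | ⟨x, hx⟩
  · simpa using Real.rpow_nonneg le_rfl _
  have hcard : (0 : ℝ) < X.card := by exact_mod_cast Finset.card_pos.2 ⟨x, hx⟩
  have hone : (1 : ℝ) ≤ (X.card : ℝ) ^ ((1 : ℝ) - ε) := by
    obtain ⟨W, hW, hWP, hxW⟩ :=
      exists_line_of_mem_planeW ((submodule_le_iff_rep_mem x _).1 (hX x hx))
    refine le_trans ?_ (hline W hW hWP)
    have hpos : 0 < {y | y ∈ X ∧ y.submodule ≤ W}.ncard :=
      (Set.ncard_pos (X.finite_toSet.subset fun y hy => hy.1)).2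
        ⟨x, hx, (submodule_le_iff_rep_mem x W).2 hxW⟩
    exact_mod_cast hpos
  have hfix := hline (fixedLine K) finrank_fixedLine fixedLine_le_planeW
  have hcount : (_ : ℝ) ≤ _ := Nat.cast_le.2 (ncard_stabilizer_pairs_le X hX)
  push_cast at hcount
  have hpow : (X.card : ℝ) ^ ((2 : ℝ) - ε) = X.card * (X.card : ℝ) ^ ((1 : ℝ) - ε) := by
    rw [show (2 : ℝ) - ε = 1 + (1 - ε) by ring, Real.rpow_add hcard, Real.rpow_one]
  rw [hpow]
  refine hcount.trans ?_
  have h1 := mul_le_mul_of_nonneg_left hone hcard.le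
  have h2 := mul_le_mul_of_nonneg_left hfix hcard.le
  linarith
end

section
/- Let K be a field and let G(K) be the group with underlying set K × K × K^× and multiplication (a,b,c)(a′,b′,c′) = (a′+ac′, b′+bc′, cc′). Then every nilpotent subgroup of G(K) is abelian. -/
namespace GK

lemma eq_one_of_commute {K : Type*} [Field K] {u t : GK K} (hu : u.c = 1) (ht : t.c ≠ 1)
    (h : u * t = t * u) : u = 1 := by
  have ht' : (t.c : K) - 1 ≠ 0 := fun h0 => ht (Units.ext (by simpa using sub_eq_zero.mp h0))
  have ha := congrArg GK.a h
  have hb := congrArg GK.b h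
  simp only [mul_a, mul_b, hu, Units.val_one] at ha hb
  ext1
  · exact (mul_eq_zero.mp (by linear_combination ha : u.a * ((t.c : K) - 1) = 0)).resolve_right ht'
  · exact (mul_eq_zero.mp (by linear_combination hb : u.b * ((t.c : K) - 1) = 0)).resolve_right ht'
  · exact hu

/-- In a nilpotent subgroup with an element acting nontrivially on translations, the only
translation is the identity. -/
lemma eq_one_of_isNilpotent {K : Type*} [Field K] {H : Subgroup (GK K)}
    (hH : Group.IsNilpotent ↥H) {t : GK K} (htH : t ∈ H) (ht : t.c ≠ 1)
    {u : GK K} (huH : u ∈ H) (hu : u.c = 1) : u = 1 := by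
  have key : ∀ (n : ℕ) (v : H), v.1.c = 1 → v ∈ Subgroup.upperCentralSeries H n → v = 1 := by
    intro n
    induction n with
    | zero =>
      intro v _ hv
      simpa using hv
    | succ n ih =>
      intro v hvc hv
      have hcomm := ih _ (by simp [commutatorElement_def, hvc]) (Subgroup.mem_upperCentralSeries_succ_iff.mp hv ⟨t, htH⟩)
      have hvt : v * ⟨t, htH⟩ = ⟨t, htH⟩ * v := by
        rwa [commutatorElement_eq_one_iff_mul_comm] at hcomm
      exact Subtype.ext (eq_one_of_commute hvc ht (congrArg Subtype.val hvt))
  obtain ⟨n, hn⟩ := hH.nilpotent'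
  exact congrArg Subtype.val (key n ⟨u, huH⟩ hu (hn ▸ Subgroup.mem_top _))

end GK

/-- Let `K` be a field and let `G(K)` be the group with underlying set
`K × K × Kˣ` and multiplication `(a,b,c)(a′,b′,c′) = (a′+ac′, b′+bc′, cc′)`.
Then every nilpotent subgroup of `G(K)` is abelian. -/
theorem nilpotent_subgroup_of_GK_is_abelian
    (K : Type*) [Field K] (H : Subgroup (GK K)) (hH : Group.IsNilpotent ↥H) :
    ∀ x ∈ H, ∀ y ∈ H, x * y = y * x := by
  intro x hx y hy
  by_cases h : x.c = 1 ∧ y.c = 1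
  · obtain ⟨hxc, hyc⟩ := h
    ext1 <;> simp [hxc, hyc, add_comm]
  · have hmem : x * y * x⁻¹ * y⁻¹ ∈ H :=
      H.mul_mem (H.mul_mem (H.mul_mem hx hy) (H.inv_mem hx)) (H.inv_mem hy)
    have hc : (x * y * x⁻¹ * y⁻¹).c = 1 := by simp
    have hone : x * y * x⁻¹ * y⁻¹ = 1 := by
      rcases not_and_or.mp h with ht | ht
      · exact GK.eq_one_of_isNilpotent hH hx ht hmem hc
      · exact GK.eq_one_of_isNilpotent hH hy ht hmem hc
    rwa [mul_inv_eq_one, mul_inv_eq_iff_eq_mul] at hone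
end

section
/- Let K be a field of characteristic p > 0, let N > 0 be an integer, let G = G(K) be the group with underlying set K × K × K^× and multiplication (a,b,c)(a′,b′,c′) = (a′+ac′, b′+bc′, cc′), and let S ⊆ G be a finite set with |S| < p^{1/N}. Suppose D ⊆ S^N is a subgroup of G, where S^N is the N-fold product set of S. Then D ∩ (K × K × {1}) = {(0,0,1)}, i.e. D meets the translation subgroup trivially. Furthermore, if H is a subgroup of G such that D is normal in H and H/D is nilpotent, then H is abelian. -/
open Pointwise

open scoped commutatorElement

namespace GK

variable {K : Type*} [Field K]

lemma pow_eq_of_c_eq_one {t : GK K} (ht : t.c = 1) (n : ℕ) :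
    t ^ n = ⟨n * t.a, n * t.b, 1⟩ := by
  induction n with
  | zero => ext <;> simp
  | succ n ih => ext <;> simp [pow_succ, ih, ht] <;> ring

lemma orderOf_eq_of_c_eq_one {p : ℕ} [Fact p.Prime] [CharP K p] {t : GK K}
    (ht : t.c = 1) (ht1 : t ≠ 1) : orderOf t = p := by
  refine orderOf_eq_prime ?_ ht1
  rw [pow_eq_of_c_eq_one ht]
  ext <;> simp

lemma eq_one_of_mem_subgroup_subset_pow {p : ℕ} [Fact p.Prime] [CharP K p] {N : ℕ}
    {S : Finset (GK K)} (hS : S.card ^ N < p) {D : Subgroup (GK K)}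
    (hD : (D : Set (GK K)) ⊆ (S : Set (GK K)) ^ N) {t : GK K} (htD : t ∈ D)
    (ht : t.c = 1) : t = 1 := by
  classical
  by_contra ht1
  rw [← Finset.coe_pow] at hD
  have hfin : Finite D := (S ^ N).finite_toSet.subset hD
  have hle : p ≤ Nat.card D := by
    rw [← orderOf_eq_of_c_eq_one (p := p) ht ht1]
    exact Nat.le_of_dvd Nat.card_pos (Subgroup.orderOf_dvd_natCard D htD)
  have hcard : Nat.card D ≤ (S ^ N).card := by
    rw [← Set.ncard_coe_finset]
    exact Set.ncard_le_ncard hD (S ^ N).finite_toSet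
  exact absurd (hle.trans (hcard.trans Finset.card_pow_le)) hS.not_ge

lemma commutator_c (x y : GK K) : ⁅x, y⁆.c = 1 := by
  simp [commutatorElement_def]

lemma commute_of_c_eq_one {x y : GK K} (hx : x.c = 1) (hy : y.c = 1) : Commute x y := by
  ext <;> simp [hx, hy, add_comm]

lemma c_eq_one_of_commute {t x : GK K} (ht : t.c = 1) (ht1 : t ≠ 1) (h : Commute t x) :
    x.c = 1 := by
  by_contra hx
  have hx' : (x.c : K) - 1 ≠ 0 := sub_ne_zero.2 fun h' => hx (Units.ext h')
  have ha := congrArg GK.a h.eq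
  have hb := congrArg GK.b h.eq
  simp only [mul_a, mul_b, ht, Units.val_one, mul_one] at ha hb
  refine ht1 (GK.ext ?_ ?_ ht)
  · exact (mul_eq_zero.1 (show t.a * ((x.c : K) - 1) = 0 by linear_combination ha)).resolve_right hx'
  · exact (mul_eq_zero.1 (show t.b * ((x.c : K) - 1) = 0 by linear_combination hb)).resolve_right hx'

lemma commute_of_isNilpotent {H : Subgroup (GK K)} [Group.IsNilpotent H] (x y : H) :
    Commute x y := by
  by_contra hxy
  obtain ⟨z, hz⟩ : ∃ z : H, (z : GK K).c ≠ 1 := by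
    by_contra! h
    exact hxy (Subtype.ext (commute_of_c_eq_one (h x) (h y)).eq)
  have key : ∀ n, ∃ t ∈ Subgroup.lowerCentralSeries (⊤ : Subgroup H) n,
      (t : GK K).c = 1 ∧ t ≠ 1 := by
    intro n
    induction n with
    | zero =>
      exact ⟨⁅x, y⁆, by simp, commutator_c _ _,
        fun h => hxy (commutatorElement_eq_one_iff_commute.1 h)⟩
    | succ n ih =>
      obtain ⟨t, htn, htc, ht1⟩ := ih
      refine ⟨⁅t, z⁆, Subgroup.commutator_mem_commutator htn (Subgroup.mem_top z),
        commutator_c _ _, fun h => hz ?_⟩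
      refine c_eq_one_of_commute htc (by simpa using ht1) ?_
      exact congrArg Subtype.val (commutatorElement_eq_one_iff_commute.1 h).eq
  obtain ⟨n, hn⟩ := Subgroup.nilpotent_iff_lowerCentralSeries.1 ‹Group.IsNilpotent H›
  obtain ⟨t, htn, -, ht1⟩ := key n
  rw [hn] at htn
  exact ht1 (Subgroup.mem_bot.1 htn)

end GK

/-- Let `K` be a field of characteristic `p > 0`, `N > 0` an integer,
`G = G(K)` the group `K × K × Kˣ` with `(a,b,c)(a′,b′,c′) = (a′+ac′, b′+bc′, cc′)`, and
`S ⊆ G` a finite set with `|S| < p^{1/N}`.  Suppose `D ⊆ S^N` is a subgroup of `G`.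
Then `D` meets the translation subgroup `K × K × {1}` trivially; furthermore, if `H ≤ G`
is such that `D` is normal in `H` and `H/D` is nilpotent, then `H` is abelian. -/
theorem GK_subgroup_in_small_power_trivial_translations
    (K : Type*) [Field K] (p : ℕ) (hp : ringChar K = p) (hppos : 0 < p)
    (N : ℕ) (hN : 0 < N) (S : Finset (GK K))
    (hS : (S.card : ℝ) < (p : ℝ) ^ ((1 : ℝ) / N))
    (D : Subgroup (GK K)) (hD : (D : Set (GK K)) ⊆ (S : Set (GK K)) ^ N) :
    ((D : Set (GK K)) ∩ {g : GK K | g.c = 1} = {1}) ∧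
      (∀ H : Subgroup (GK K), D ≤ H → ∀ hn : (D.subgroupOf H).Normal,
        (haveI := hn
         Group.IsNilpotent (↥H ⧸ D.subgroupOf H)) →
        ∀ x ∈ H, ∀ y ∈ H, x * y = y * x) := by
  have hchar : CharP K p := hp ▸ ringChar.charP K
  have hprime : Fact p.Prime :=
    ⟨(CharP.char_is_prime_or_zero K p).resolve_right hppos.ne'⟩
  have hcard : S.card ^ N < p := by
    have h := pow_lt_pow_left₀ hS (Nat.cast_nonneg _) hN.ne'
    rw [one_div, Real.rpow_inv_natCast_pow (Nat.cast_nonneg _) hN.ne'] at h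
    exact_mod_cast h
  have htriv : ∀ t ∈ D, t.c = 1 → t = 1 := fun t htD ht =>
    GK.eq_one_of_mem_subgroup_subset_pow hcard hD htD ht
  refine ⟨?_, fun H hDH hn hnil x hx y hy => ?_⟩
  · refine Set.Subset.antisymm (fun t ht => htriv t ht.1 ht.2) ?_
    rintro _ rfl
    exact ⟨D.one_mem, rfl⟩
  · have hker : (QuotientGroup.mk' (D.subgroupOf H)).ker ≤ Subgroup.center H := by
      rw [QuotientGroup.ker_mk']
      intro d hd
      refine Subgroup.mem_center_iff.2 fun h => ?_
      have hmem : ⁅h, d⁆ ∈ D.subgroupOf H :=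
        (D.subgroupOf H).mul_mem (hn.conj_mem d hd h) ((D.subgroupOf H).inv_mem hd)
      have h1 : ⁅h, d⁆ = 1 :=
        Subtype.ext (htriv _ (Subgroup.mem_subgroupOf.1 hmem) (GK.commutator_c _ _))
      exact (commutatorElement_eq_one_iff_commute.1 h1).eq
    have : Group.IsNilpotent H := Subgroup.isNilpotent_of_ker_le_center _ hker
    exact congrArg Subtype.val (GK.commute_of_isNilpotent (⟨x, hx⟩ : H) ⟨y, hy⟩).eq
end
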